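/- Let μ = μ_P be the conformal measure on the prime Cantor set Λ_P and δ = δ_P its conformal dimension. Assume that 0 < R_1 < ∞ and 0 < R_2 < ∞ (the cases k = 1, 2 of the Cramér–Granville-type conjecture). Then 0 < P^ψ(μ) < ∞, where ψ(r) = r^δ · (loglog(1/r))^{-2δ}. -/

import Mathlib

open MeasureTheory Metric Filter Set
open scoped ENNReal Topology NNReal

noncomputable section

/-- The Gauss map `φ_a(x) = 1/(a+x)`. -/
def gaussMap (a : ℕ) (x : ℝ) : ℝ := 1 / (a + x)

/-- `φ_ω = φ_{ω₁} ∘ ⋯ ∘ φ_{ω_n}` for a finite word `ω`. -/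
def wordMap : List ℕ → ℝ → ℝ
  | [] => fun x => x
  | a :: ω => fun x => gaussMap a (wordMap ω x)

/-- `‖φ_ω'‖ = sup_{x ∈ [0,1]} |φ_ω'(x)|`. -/
def derivNorm (ω : List ℕ) : ℝ := ⨆ x : Icc (0 : ℝ) 1, |deriv (wordMap ω) (x : ℝ)|

/-- The cylinder `[ω] = φ_ω([0,1])`. -/
def cyl (ω : List ℕ) : Set ℝ := wordMap ω '' Icc 0 1

/-- The set of finite words over the alphabet `E`. -/
def words (E : Set ℕ) : Set (List ℕ) := {ω | ∀ a ∈ ω, a ∈ E}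

/-- The coding map `π(ω) = [0; ω₀, ω₁, …]`. -/
def codingMap (ω : ℕ → ℕ) : ℝ :=
  limUnder atTop fun n => wordMap (List.ofFn fun i : Fin n => ω i) 0

/-- The limit set `Λ_E`. -/
def limitSet (E : Set ℕ) : Set ℝ := codingMap '' {ω | ∀ n, ω n ∈ E}

/-- The pressure function of the Gauss IFS on the alphabet `E`. -/
def pressure (E : Set ℕ) (s : ℝ) : ℝ :=
  limUnder atTop fun n : ℕ =>
    (n : ℝ)⁻¹ * Real.log (∑' ω : Fin n → E, derivNorm (List.ofFn fun i => (ω i : ℕ)) ^ s)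

/-- `μ` is the `δ`-conformal measure of the Gauss IFS on the alphabet `E`. -/
def IsConformal (E : Set ℕ) (δ : ℝ) (μ : Measure ℝ) : Prop :=
  IsProbabilityMeasure μ ∧ μ (limitSet E)ᶜ = 0 ∧
    ∀ A : Set ℝ, A ⊆ Icc 0 1 → MeasurableSet A →
      μ A = ∑' a : E, ENNReal.ofReal (∫ x in gaussMap (a : ℕ) ⁻¹' A, |deriv (gaussMap (a : ℕ)) x| ^ δ ∂μ)

/-- The set of prime numbers. -/
def primes : Set ℕ := {p | p.Prime}

/-- `μ(J) = ∑_{a ∈ J} μ([a])` for a set of letters `J`. -/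
def cylMass (μ : Measure ℝ) (J : Set ℕ) : ℝ≥0∞ := ∑' a : J, μ (cyl [(a : ℕ)])

/-- A dimension function: continuous, increasing, positive, with `ψ(0⁺) = 0`. -/
def IsDimFun (ψ : ℝ → ℝ) : Prop :=
  ContinuousOn ψ (Ioi 0) ∧ MonotoneOn ψ (Ioi 0) ∧ (∀ r : ℝ, 0 < r → 0 < ψ r) ∧
    Tendsto ψ (𝓝[>] (0 : ℝ)) (𝓝 0)

/-- A doubling function. -/
def IsDoubling (ψ : ℝ → ℝ) : Prop :=
  ∀ C₁ : ℝ, 1 ≤ C₁ → ∃ C₂ : ℝ, 1 ≤ C₂ ∧ ∀ x y : ℝ, 0 < x → 0 < y →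
    C₁⁻¹ ≤ x / y → x / y ≤ C₁ → C₂⁻¹ ≤ ψ x / ψ y ∧ ψ x / ψ y ≤ C₂

open Classical in
/-- The `ψ`-dimensional Hausdorff measure `H^ψ`. -/
def hausdorffPsi (ψ : ℝ → ℝ) : Measure ℝ :=
  Measure.mkMetric fun d => if d = 0 then 0 else ENNReal.ofReal (ψ d.toReal)

/-- `H^ψ(μ) = inf {H^ψ(A) : A Borel, μ(ℝ∖A) = 0}`. -/
def hausdorffPsiOf (ψ : ℝ → ℝ) (μ : Measure ℝ) : ℝ≥0∞ :=
  ⨅ (A : Set ℝ) (_ : MeasurableSet A) (_ : μ Aᶜ = 0), hausdorffPsi ψ A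

/-- The `ψ`-dimensional packing pre-measure `P̃^ψ`. -/
def packingPre (ψ : ℝ → ℝ) (A : Set ℝ) : ℝ≥0∞ :=
  ⨅ (ε : ℝ) (_ : 0 < ε),
    ⨆ (D : Set (ℝ × ℝ)) (_ : D.Countable)
      (_ : ∀ p ∈ D, p.1 ∈ A ∧ 0 < p.2 ∧ 2 * p.2 ≤ ε)
      (_ : D.PairwiseDisjoint fun p => closedBall p.1 p.2),
      ∑' p : D, ENNReal.ofReal (ψ (2 * (p : ℝ × ℝ).2))

/-- The `ψ`-dimensional packing measure `P^ψ`. -/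
def packingPsi (ψ : ℝ → ℝ) (A : Set ℝ) : ℝ≥0∞ :=
  ⨅ (S : ℕ → Set ℝ) (_ : A ⊆ ⋃ i, S i), ∑' i, packingPre ψ (S i)

/-- `P^ψ(μ) = inf {P^ψ(A) : A Borel, μ(ℝ∖A) = 0}`. -/
def packingPsiOf (ψ : ℝ → ℝ) (μ : Measure ℝ) : ℝ≥0∞ :=
  ⨅ (A : Set ℝ) (_ : MeasurableSet A) (_ : μ Aᶜ = 0), packingPsi ψ A

/-- Assumption C with constant `λ`: `μ({a : λ⁻¹r < ‖φ_a'‖ ≤ r}) ≍ μ({a : ‖φ_a'‖ ≤ r})`. -/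
def AssumptionC (E : Set ℕ) (μ : Measure ℝ) (lam : ℝ) : Prop :=
  ∃ c C : ℝ≥0∞, 0 < c ∧ C ≠ ⊤ ∧ ∀ r : ℝ, 0 < r → r ≤ 1 →
    c * cylMass μ {a ∈ E | derivNorm [a] ≤ r} ≤
        cylMass μ {a ∈ E | lam⁻¹ * r < derivNorm [a] ∧ derivNorm [a] ≤ r} ∧
      cylMass μ {a ∈ E | lam⁻¹ * r < derivNorm [a] ∧ derivNorm [a] ≤ r} ≤
        C * cylMass μ {a ∈ E | derivNorm [a] ≤ r}

/-- `f` is regularly varying with exponent `s`. -/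
def RegVarying (f : ℝ → ℝ) (s : ℝ) : Prop :=
  ∀ a : ℝ, 1 < a → Tendsto (fun x => f (a * x) / f x) atTop (𝓝 (a ^ s))

/-- Assumption 1: `#(E ∩ [N,2N]) ≍ f(N)`. -/
def Assumption1 (E : Set ℕ) (f : ℝ → ℝ) : Prop :=
  ∃ c C : ℝ, 0 < c ∧ 0 < C ∧ ∀ N : ℕ, 1 ≤ N →
    c * f N ≤ ((E ∩ Icc N (2 * N)).ncard : ℝ) ∧ ((E ∩ Icc N (2 * N)).ncard : ℝ) ≤ C * f N

/-- Assumption 3: the Lyapunov exponent `-∑_{a∈E} μ(a) log ‖φ_a'‖` is finite. -/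
def Assumption3 (E : Set ℕ) (μ : Measure ℝ) : Prop :=
  Summable fun a : E => (μ (cyl [(a : ℕ)])).toReal * Real.log (derivNorm [(a : ℕ)])

/-- `W_k = {ω : λ^{-(k+1)} < ‖φ_ω'‖ ≤ λ^{-k}}`. -/
def W (lam : ℝ) (k : ℕ) : Set (List ℕ) :=
  {ω | lam ^ (-(k : ℝ) - 1) < derivNorm ω ∧ derivNorm ω ≤ lam ^ (-(k : ℝ))}

/-- `A_k = ⋃ {[ωa] : ω ∈ W_k ∩ E^*, a ∈ J}`. -/
def cylUnion (E : Set ℕ) (lam : ℝ) (k : ℕ) (J : Set ℕ) : Set ℝ :=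
  ⋃ ω ∈ W lam k ∩ words E, ⋃ a ∈ J, cyl (ω ++ [a])

/-- `S_J`: sequences in `E^ℕ` with infinitely many `(n,k)` such that `ω|n ∈ W_k`, `ω_{n+1} ∈ J_k`. -/
def Sset (E : Set ℕ) (lam : ℝ) (J : ℕ → Set ℕ) : Set (ℕ → ℕ) :=
  {ω | (∀ n, ω n ∈ E) ∧
    {p : ℕ × ℕ | (List.ofFn fun i : Fin p.1 => ω i) ∈ W lam p.2 ∧ ω p.1 ∈ J p.2}.Infinite}

/-- The upper density `D̄^ψ_μ(x)`. -/
def upperDensity (ψ : ℝ → ℝ) (μ : Measure ℝ) (x : ℝ) : ℝ≥0∞ :=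
  limsup (fun r => μ (closedBall x r) / ENNReal.ofReal (ψ r)) (𝓝[>] (0 : ℝ))

/-- The lower density `D̲^ψ_μ(x)`. -/
def lowerDensity (ψ : ℝ → ℝ) (μ : Measure ℝ) (x : ℝ) : ℝ≥0∞ :=
  liminf (fun r => μ (closedBall x r) / ENNReal.ofReal (ψ r)) (𝓝[>] (0 : ℝ))

/-- `J_{k,α,1} = {a ∈ E : ∃ r ∈ [‖φ_a'‖,1], r^{-δ} μ(B([a],r)) ≥ α Ψ(λ^{-k} r)}`. -/
def JsetH (E : Set ℕ) (δ : ℝ) (μ : Measure ℝ) (Ψ : ℝ → ℝ) (lam : ℝ) (k : ℕ) (α : ℝ) : Set ℕ :=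
  {a ∈ E | ∃ r : ℝ, derivNorm [a] ≤ r ∧ r ≤ 1 ∧
    ENNReal.ofReal (α * r ^ δ * Ψ (lam ^ (-(k : ℝ)) * r)) ≤ μ (cthickening r (cyl [a]))}

/-- `J_{k,α,-1} = {a ∈ E : ∃ r ∈ [‖φ_a'‖,1], r^{-δ} μ(B([a],r)) ≤ α Ψ(λ^{-k} r)}`. -/
def JsetP (E : Set ℕ) (δ : ℝ) (μ : Measure ℝ) (Ψ : ℝ → ℝ) (lam : ℝ) (k : ℕ) (α : ℝ) : Set ℕ :=
  {a ∈ E | ∃ r : ℝ, derivNorm [a] ≤ r ∧ r ≤ 1 ∧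
    μ (cthickening r (cyl [a])) ≤ ENNReal.ofReal (α * r ^ δ * Ψ (lam ^ (-(k : ℝ)) * r))}

/-- `S_{α,1}`. -/
def SsetH (E : Set ℕ) (δ : ℝ) (μ : Measure ℝ) (Ψ : ℝ → ℝ) (lam : ℝ) (α : ℝ) : Set (ℕ → ℕ) :=
  {ω | {p : ℕ × ℕ | (List.ofFn fun i : Fin p.1 => ω i) ∈ W lam p.2 ∧
    ω p.1 ∈ JsetH E δ μ Ψ lam p.2 α}.Infinite}

/-- `S_{α,-1}`. -/
def SsetP (E : Set ℕ) (δ : ℝ) (μ : Measure ℝ) (Ψ : ℝ → ℝ) (lam : ℝ) (α : ℝ) : Set (ℕ → ℕ) :=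
  {ω | {p : ℕ × ℕ | (List.ofFn fun i : Fin p.1 => ω i) ∈ W lam p.2 ∧
    ω p.1 ∈ JsetP E δ μ Ψ lam p.2 α}.Infinite}

/-- `M(x,pre,r) = ∑_{a ∈ E, [pre·a] ⊆ B(x,r)} μ([pre·a])`. -/
def Mform (E : Set ℕ) (μ : Measure ℝ) (x : ℝ) (pre : List ℕ) (r : ℝ) : ℝ≥0∞ :=
  ∑' a : {a : ℕ // a ∈ E ∧ cyl (pre ++ [a]) ⊆ closedBall x r}, μ (cyl (pre ++ [(a : ℕ)]))

/-- The Gauss transformation `x ↦ {1/x}`. -/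
def gaussT (x : ℝ) : ℝ := Int.fract x⁻¹

/-- The first continued fraction digit `⌊1/x⌋`. -/
def digit (x : ℝ) : ℕ := ⌊x⁻¹⌋₊

/-- The first `n` continued fraction digits. -/
def digits : ℕ → ℝ → List ℕ
  | 0, _ => []
  | n + 1, x => digit x :: digits n (gaussT x)

/-- The denominator of `φ_ω(x)`, normalised so that `|φ_ω'| = den ω ^ (-2)`. -/
def den : List ℕ → ℝ → ℝ
  | [], _ => 1
  | a :: ω, x => (a + wordMap ω x) * den ω x

/-- Points of `(0,1)` with infinitely many continued fraction digits, all of them prime. -/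
def primeCantor : Set ℝ :=
  {x | ∀ n, gaussT^[n] x ∈ Ioo (0 : ℝ) 1 ∧ (digit (gaussT^[n] x)).Prime}

lemma gaussMap_pos {a : ℕ} (ha : 2 ≤ a) {x : ℝ} (hx : 0 ≤ x) : 0 < gaussMap a x := by
  have : (2 : ℝ) ≤ a := by exact_mod_cast ha
  unfold gaussMap; positivity

lemma gaussMap_le_half {a : ℕ} (ha : 2 ≤ a) {x : ℝ} (hx : 0 ≤ x) : gaussMap a x ≤ 1 / 2 := by
  have : (2 : ℝ) ≤ a := by exact_mod_cast ha
  unfold gaussMap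
  exact one_div_le_one_div_of_le (by norm_num) (by linarith)

lemma gaussMap_mem_Ioo {a : ℕ} (ha : 2 ≤ a) {x : ℝ} (hx : 0 ≤ x) :
    gaussMap a x ∈ Ioo (0 : ℝ) 1 :=
  ⟨gaussMap_pos ha hx, (gaussMap_le_half ha hx).trans_lt (by norm_num)⟩

lemma wordMap_mem_Icc {ω : List ℕ} (hω : ∀ a ∈ ω, 2 ≤ a) {x : ℝ} (hx : x ∈ Icc (0 : ℝ) 1) :
    wordMap ω x ∈ Icc (0 : ℝ) 1 := by
  induction ω with
  | nil => exact hx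
  | cons a ω ih =>
    have h := ih fun b hb => hω b (List.mem_cons_of_mem _ hb)
    exact Ioo_subset_Icc_self (gaussMap_mem_Ioo (hω a (by simp)) h.1)

lemma wordMap_mem_Ioo {ω : List ℕ} (hω : ∀ a ∈ ω, 2 ≤ a) {x : ℝ} (hx : x ∈ Ioo (0 : ℝ) 1) :
    wordMap ω x ∈ Ioo (0 : ℝ) 1 := by
  induction ω with
  | nil => exact hx
  | cons a ω ih =>
    have h := ih fun b hb => hω b (List.mem_cons_of_mem _ hb)
    exact gaussMap_mem_Ioo (hω a (by simp)) h.1.le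

lemma wordMap_append (ω τ : List ℕ) (x : ℝ) :
    wordMap (ω ++ τ) x = wordMap ω (wordMap τ x) := by
  induction ω with
  | nil => rfl
  | cons a ω ih => simp [wordMap, ih]

lemma two_pow_le_den {ω : List ℕ} (hω : ∀ a ∈ ω, 2 ≤ a) {x : ℝ} (hx : x ∈ Icc (0 : ℝ) 1) :
    2 ^ ω.length ≤ den ω x := by
  induction ω with
  | nil => simp [den]
  | cons a ω ih =>
    have hω' : ∀ b ∈ ω, 2 ≤ b := fun b hb => hω b (List.mem_cons_of_mem _ hb)
    have ha : (2 : ℝ) ≤ a := by exact_mod_cast hω a (by simp)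
    have hw := (wordMap_mem_Icc hω' hx).1
    have := ih hω'
    rw [List.length_cons, pow_succ', den]
    gcongr
    linarith

lemma den_pos {ω : List ℕ} (hω : ∀ a ∈ ω, 2 ≤ a) {x : ℝ} (hx : x ∈ Icc (0 : ℝ) 1) :
    0 < den ω x :=
  lt_of_lt_of_le (by positivity) (two_pow_le_den hω hx)

lemma den_le_two_mul_den {ω : List ℕ} (hω : ∀ a ∈ ω, 2 ≤ a) {x y : ℝ}
    (hx : x ∈ Icc (0 : ℝ) 1) (hy : y ∈ Icc (0 : ℝ) 1) : den ω x ≤ 2 * den ω y := by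
  suffices h : den ω x ≤ 2 * den ω y ∧
      (1 + wordMap ω x) * den ω x ≤ 2 * ((1 + wordMap ω y) * den ω y) from h.1
  induction ω with
  | nil => simp only [den, wordMap]; constructor <;> linarith [hx.2, hy.1]
  | cons a ω ih =>
    have hω' : ∀ b ∈ ω, 2 ≤ b := fun b hb => hω b (List.mem_cons_of_mem _ hb)
    have ha : (2 : ℝ) ≤ a := by exact_mod_cast hω a (by simp)
    obtain ⟨h1, h2⟩ := ih hω'
    have h3 : ((a : ℝ) - 1) * den ω x ≤ (a - 1) * (2 * den ω y) := by gcongr; linarith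
    have key : ∀ z ∈ Icc (0 : ℝ) 1, (1 + wordMap (a :: ω) z) * den (a :: ω) z =
        (a + wordMap ω z) * den ω z + den ω z := by
      intro z hz
      have := (wordMap_mem_Icc hω' hz).1
      have h0 : (a : ℝ) + wordMap ω z ≠ 0 := by positivity
      simp only [wordMap, den, gaussMap]
      field_simp
    rw [key x hx, key y hy]
    simp only [den]
    constructor <;> nlinarith

lemma wordMap_sub_wordMap {ω : List ℕ} (hω : ∀ a ∈ ω, 2 ≤ a) {x y : ℝ}
    (hx : x ∈ Icc (0 : ℝ) 1) (hy : y ∈ Icc (0 : ℝ) 1) :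
    wordMap ω x - wordMap ω y = (-1) ^ ω.length * (x - y) / (den ω x * den ω y) := by
  induction ω with
  | nil => simp [wordMap, den]
  | cons a ω ih =>
    have hω' : ∀ b ∈ ω, 2 ≤ b := fun b hb => hω b (List.mem_cons_of_mem _ hb)
    have ha : (2 : ℝ) ≤ a := by exact_mod_cast hω a (by simp)
    have h1 := (wordMap_mem_Icc hω' hx).1
    have h2 := (wordMap_mem_Icc hω' hy).1
    have h3 := den_pos hω' hx
    have h4 := den_pos hω' hy
    have h5 : (a : ℝ) + wordMap ω x ≠ 0 := by positivity
    have h6 : (a : ℝ) + wordMap ω y ≠ 0 := by positivity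
    have ih' := ih hω'
    rw [eq_div_iff (by positivity)] at ih'
    simp only [wordMap, den, gaussMap, List.length_cons, pow_succ]
    rw [div_sub_div _ _ h5 h6, div_eq_div_iff (by positivity) (by positivity)]
    linear_combination -((a : ℝ) + wordMap ω x) * ((a : ℝ) + wordMap ω y) * ih'

lemma abs_wordMap_sub_wordMap {ω : List ℕ} (hω : ∀ a ∈ ω, 2 ≤ a) {x y : ℝ}
    (hx : x ∈ Icc (0 : ℝ) 1) (hy : y ∈ Icc (0 : ℝ) 1) :
    |wordMap ω x - wordMap ω y| = |x - y| / (den ω x * den ω y) := by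
  have := den_pos hω hx
  have := den_pos hω hy
  rw [wordMap_sub_wordMap hω hx hy, abs_div, abs_mul, abs_pow, abs_neg, abs_one, one_pow, one_mul,
    abs_of_pos (a := den ω x * den ω y) (by positivity)]

lemma injOn_wordMap {ω : List ℕ} (hω : ∀ a ∈ ω, 2 ≤ a) : InjOn (wordMap ω) (Icc 0 1) := by
  intro x hx y hy hxy
  have h := abs_wordMap_sub_wordMap hω hx hy
  have := den_pos hω hx
  have := den_pos hω hy
  rw [hxy, sub_self, abs_zero, eq_comm, div_eq_zero_iff] at h
  rcases h with h | h
  · exact sub_eq_zero.1 (abs_eq_zero.1 h)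
  · exact absurd h (by positivity)

lemma continuousOn_wordMap {ω : List ℕ} (hω : ∀ a ∈ ω, 2 ≤ a) :
    ContinuousOn (wordMap ω) (Icc 0 1) := by
  induction ω with
  | nil => exact continuousOn_id
  | cons a ω ih =>
    have hω' : ∀ b ∈ ω, 2 ≤ b := fun b hb => hω b (List.mem_cons_of_mem _ hb)
    have ha : (2 : ℝ) ≤ a := by exact_mod_cast hω a (by simp)
    refine ContinuousOn.div continuousOn_const (continuousOn_const.add (ih hω')) fun x hx => ?_
    have := (wordMap_mem_Icc hω' hx).1
    positivity

lemma measurable_gaussMap (a : ℕ) : Measurable (gaussMap a) := by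
  unfold gaussMap; fun_prop

lemma measurable_wordMap (ω : List ℕ) : Measurable (wordMap ω) := by
  induction ω with
  | nil => exact measurable_id
  | cons a ω ih => exact (measurable_gaussMap a).comp ih

lemma measurable_gaussT : Measurable gaussT := measurable_fract.comp measurable_inv

lemma measurable_digit : Measurable digit := Nat.measurable_floor.comp measurable_inv

lemma digit_gaussMap (a : ℕ) {x : ℝ} (hx : x ∈ Ioo (0 : ℝ) 1) : digit (gaussMap a x) = a := by
  have := hx.1
  rw [digit, gaussMap, one_div, inv_inv, Nat.floor_eq_iff (by positivity)]
  exact ⟨by linarith, by linarith [hx.2]⟩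

lemma gaussT_gaussMap (a : ℕ) {x : ℝ} (hx : x ∈ Ioo (0 : ℝ) 1) : gaussT (gaussMap a x) = x := by
  rw [gaussT, gaussMap, one_div, inv_inv, Int.fract_natCast_add]
  exact Int.fract_eq_self.2 ⟨hx.1.le, hx.2⟩

lemma gaussMap_digit {x : ℝ} (hx : 0 < x) : gaussMap (digit x) (gaussT x) = x := by
  have h : ((⌊x⁻¹⌋₊ : ℕ) : ℝ) + Int.fract x⁻¹ = x⁻¹ := by
    rw [natCast_floor_eq_intCast_floor (by positivity)]
    exact Int.floor_add_fract _
  rw [gaussMap, digit, gaussT, h, one_div, inv_inv]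

lemma length_digits (n : ℕ) (x : ℝ) : (digits n x).length = n := by
  induction n generalizing x with
  | zero => rfl
  | succ n ih => simp [digits, ih]

lemma digits_wordMap {ω : List ℕ} (hω : ∀ a ∈ ω, 2 ≤ a) {x : ℝ} (hx : x ∈ Ioo (0 : ℝ) 1) :
    digits ω.length (wordMap ω x) = ω ∧ gaussT^[ω.length] (wordMap ω x) = x := by
  induction ω with
  | nil => exact ⟨rfl, rfl⟩
  | cons a ω ih =>
    have hω' : ∀ b ∈ ω, 2 ≤ b := fun b hb => hω b (List.mem_cons_of_mem _ hb)
    have hw := wordMap_mem_Ioo hω' hx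
    obtain ⟨h1, h2⟩ := ih hω'
    rw [List.length_cons, digits, Function.iterate_succ_apply, wordMap, digit_gaussMap a hw,
      gaussT_gaussMap a hw, h1, h2]
    exact ⟨rfl, rfl⟩

lemma gaussT_mem_primeCantor {x : ℝ} (hx : x ∈ primeCantor) : gaussT x ∈ primeCantor := by
  intro n
  simpa [Function.iterate_succ_apply] using hx (n + 1)

lemma iterate_mem_primeCantor {x : ℝ} (hx : x ∈ primeCantor) (n : ℕ) :
    gaussT^[n] x ∈ primeCantor := by
  intro m
  simpa [← Function.iterate_add_apply] using hx (m + n)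

lemma primeCantor_mem_Ioo {x : ℝ} (hx : x ∈ primeCantor) : x ∈ Ioo (0 : ℝ) 1 := (hx 0).1

lemma primeCantor_digit_prime {x : ℝ} (hx : x ∈ primeCantor) : (digit x).Prime := (hx 0).2

lemma primeCantor_le_half {x : ℝ} (hx : x ∈ primeCantor) : x ≤ 1 / 2 := by
  rw [← gaussMap_digit (primeCantor_mem_Ioo hx).1]
  exact gaussMap_le_half (primeCantor_digit_prime hx).two_le
    (primeCantor_mem_Ioo (gaussT_mem_primeCantor hx)).1.le

lemma prime_of_mem_digits {x : ℝ} (hx : x ∈ primeCantor) (n : ℕ) :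
    ∀ a ∈ digits n x, a.Prime := by
  induction n generalizing x with
  | zero => simp [digits]
  | succ n ih =>
    intro a ha
    rcases List.mem_cons.1 ha with rfl | ha
    · exact primeCantor_digit_prime hx
    · exact ih (gaussT_mem_primeCantor hx) a ha

lemma wordMap_digits {x : ℝ} (hx : x ∈ primeCantor) (n : ℕ) :
    wordMap (digits n x) (gaussT^[n] x) = x := by
  induction n generalizing x with
  | zero => rfl
  | succ n ih =>
    rw [Function.iterate_succ_apply]
    change gaussMap (digit x) (wordMap (digits n (gaussT x)) (gaussT^[n] (gaussT x))) = x
    rw [ih (gaussT_mem_primeCantor hx), gaussMap_digit (primeCantor_mem_Ioo hx).1]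

lemma den_digits {x : ℝ} (hx : x ∈ primeCantor) (n : ℕ) :
    den (digits n x) (gaussT^[n] x) = ∏ i ∈ Finset.range n, (gaussT^[i] x)⁻¹ := by
  induction n generalizing x with
  | zero => rfl
  | succ n ih =>
    have hT := gaussT_mem_primeCantor hx
    have h := gaussMap_digit (primeCantor_mem_Ioo hx).1
    rw [digits, den, Function.iterate_succ_apply, wordMap_digits hT, ih hT,
      Finset.prod_range_succ', mul_comm]
    congr 1
    rw [gaussMap, one_div] at h
    rw [Function.iterate_zero_apply, ← inv_inv ((digit x : ℝ) + gaussT x), h]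

lemma measurableSet_primeCantor : MeasurableSet primeCantor := by
  have h : primeCantor = ⋂ n, (gaussT^[n]) ⁻¹' (Ioo (0 : ℝ) 1 ∩ digit ⁻¹' {p | p.Prime}) := by
    ext x; simp [primeCantor]
  rw [h]
  exact MeasurableSet.iInter fun n => (measurable_gaussT.iterate n)
    (measurableSet_Ioo.inter (measurable_digit (MeasurableSet.of_discrete)))

lemma tendsto_codingMap {ω : ℕ → ℕ} (hω : ∀ n, 2 ≤ ω n) :
    Tendsto (fun n => wordMap (List.ofFn fun i : Fin n => ω i) 0) atTop (𝓝 (codingMap ω)) := by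
  have hmem : ∀ n, ∀ a ∈ List.ofFn (fun i : Fin n => ω i), 2 ≤ a := by
    intro n a ha
    obtain ⟨i, rfl⟩ := (List.mem_ofFn' _ _).1 ha
    exact hω i
  have h0 : (0 : ℝ) ∈ Icc (0 : ℝ) 1 := by simp
  refine CauchySeq.tendsto_limUnder (cauchySeq_of_le_geometric (1 / 2) 1 (by norm_num) fun n => ?_)
  have h1 : (List.ofFn fun i : Fin (n + 1) => ω i) = (List.ofFn fun i : Fin n => ω i) ++ [ω n] := by
    rw [List.ofFn_succ']; simp
  have h2 := Ioo_subset_Icc_self (gaussMap_mem_Ioo (hω n) (le_refl 0))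
  rw [h1, wordMap_append, Real.dist_eq, show wordMap [ω n] 0 = gaussMap (ω n) 0 from rfl,
    abs_wordMap_sub_wordMap (hmem n) h0 h2, one_mul, one_div,
    inv_pow, ← one_div]
  have h3 := two_pow_le_den (hmem n) h0
  have h4 := two_pow_le_den (hmem n) h2
  rw [List.length_ofFn] at h3 h4
  have h5 : (1 : ℝ) ≤ 2 ^ n := one_le_pow₀ (by norm_num)
  refine div_le_div₀ zero_le_one ?_ (by positivity) (by nlinarith)
  rw [zero_sub, abs_neg, abs_of_nonneg h2.1]
  exact h2.2

lemma codingMap_eq {ω : ℕ → ℕ} (hω : ∀ n, 2 ≤ ω n) :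
    codingMap (fun n => ω (n + 1)) ∈ Icc (0 : ℝ) 1 ∧
      codingMap ω = gaussMap (ω 0) (codingMap fun n => ω (n + 1)) := by
  have h1 := tendsto_codingMap fun n => hω (n + 1)
  have hmem : codingMap (fun n => ω (n + 1)) ∈ Icc (0 : ℝ) 1 := by
    refine isClosed_Icc.mem_of_tendsto h1 (Eventually.of_forall fun n => ?_)
    refine wordMap_mem_Icc (fun a ha => ?_) (by simp)
    obtain ⟨i, rfl⟩ := (List.mem_ofFn' _ _).1 ha
    exact hω _
  refine ⟨hmem, ?_⟩
  have h2 := (tendsto_add_atTop_iff_nat 1).2 (tendsto_codingMap hω)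
  refine tendsto_nhds_unique h2 ?_
  have h3 : ContinuousAt (gaussMap (ω 0)) (codingMap fun n => ω (n + 1)) := by
    refine ContinuousAt.div continuousAt_const (continuousAt_const.add continuousAt_id) ?_
    have : (2 : ℝ) ≤ ω 0 := by exact_mod_cast hω 0
    have := hmem.1
    positivity
  refine (h3.tendsto.comp h1).congr fun n => ?_
  rw [List.ofFn_succ]
  rfl

lemma limitSet_primes_subset : limitSet primes ⊆ primeCantor := by
  rintro _ ⟨ω, hω, rfl⟩
  have h2 : ∀ n, 2 ≤ ω n := fun n => (hω n : (ω n).Prime).two_le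
  have key : ∀ n, codingMap (fun i => ω (i + n)) ∈ Ioo (0 : ℝ) 1 := fun n => by
    obtain ⟨h3, h4⟩ := codingMap_eq (ω := fun i => ω (i + n)) fun i => h2 _
    rw [h4]
    exact gaussMap_mem_Ioo (h2 _) h3.1
  have hstep : ∀ n, codingMap (fun i => ω (i + n)) =
      gaussMap (ω n) (codingMap fun i => ω (i + (n + 1))) := fun n => by
    have := (codingMap_eq (ω := fun i => ω (i + n)) fun i => h2 _).2
    simpa [add_assoc, add_comm 1 n] using this
  have hiter : ∀ n, gaussT^[n] (codingMap ω) = codingMap fun i => ω (i + n) := by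
    intro n
    induction n with
    | zero => rfl
    | succ n ih => rw [Function.iterate_succ_apply', ih, hstep, gaussT_gaussMap _ (key _)]
  intro n
  rw [hiter]
  refine ⟨key n, ?_⟩
  rw [hstep, digit_gaussMap _ (key _)]
  exact hω n

lemma abs_deriv_gaussMap_rpow {a : ℕ} {x : ℝ} (hx : 0 < x) (δ : ℝ) :
    |deriv (gaussMap a) x| ^ δ = ((a : ℝ) + x) ^ (-(2 * δ)) := by
  have h0 : 0 < (a : ℝ) + x := by positivity
  have h1 : HasDerivAt (gaussMap a) (-1 / ((a : ℝ) + x) ^ 2) x := by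
    have := ((hasDerivAt_id x).const_add (a : ℝ)).inv h0.ne'
    have h2 : gaussMap a = fun y : ℝ => ((a : ℝ) + y)⁻¹ := funext fun y => one_div _
    rw [h2]
    simpa [Pi.inv_def] using this
  rw [h1.deriv, abs_div, abs_neg, abs_one, abs_of_pos (by positivity), one_div, ← Real.rpow_natCast,
    ← Real.rpow_neg h0.le, ← Real.rpow_mul h0.le]
  norm_num

lemma IsConformal.ae_mem {δ : ℝ} {μ : Measure ℝ} (hμ : IsConformal primes δ μ) :
    ∀ᵐ x ∂μ, x ∈ primeCantor :=
  measure_mono_null (compl_subset_compl.2 limitSet_primes_subset) hμ.2.1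

lemma IsConformal.measure_Ioo {δ : ℝ} {μ : Measure ℝ} (hμ : IsConformal primes δ μ) :
    μ (Ioo 0 1) = 1 := by
  have := hμ.1
  exact (prob_compl_eq_zero_iff measurableSet_Ioo).1
    (hμ.ae_mem.mono fun x hx => primeCantor_mem_Ioo hx)

lemma measurableSet_wordMap_image {ω : List ℕ} (hω : ∀ a ∈ ω, 2 ≤ a) {B : Set ℝ}
    (hB : MeasurableSet B) (hB' : B ⊆ Ioo 0 1) : MeasurableSet (wordMap ω '' B) := by
  have h := hB'.trans Ioo_subset_Icc_self
  exact hB.image_of_continuousOn_injOn ((continuousOn_wordMap hω).mono h)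
    ((injOn_wordMap hω).mono h)

lemma IsConformal.measure_gaussMap_image {δ : ℝ} (hδ : 0 < δ) {μ : Measure ℝ}
    (hμ : IsConformal primes δ μ) {b : ℕ} (hb : b.Prime) {B : Set ℝ} (hB : MeasurableSet B)
    (hB' : B ⊆ Ioo 0 1) :
    μ (gaussMap b '' B) = ∫⁻ x in B, ENNReal.ofReal (((b : ℝ) + x) ^ (-(2 * δ))) ∂μ := by
  have := hμ.1
  have hm : MeasurableSet (gaussMap b '' B) :=
    measurableSet_wordMap_image (ω := [b]) (by simpa using hb.two_le) hB hB'
  have hsub : gaussMap b '' B ⊆ Icc 0 1 := by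
    rintro _ ⟨x, hx, rfl⟩
    exact Ioo_subset_Icc_self (gaussMap_mem_Ioo hb.two_le (hB' hx).1.le)
  have hIoo : ∀ᵐ x ∂μ, x ∈ Ioo (0 : ℝ) 1 := hμ.ae_mem.mono fun x hx => primeCantor_mem_Ioo hx
  have hpre : ∀ a : ℕ, ∀ x ∈ Ioo (0 : ℝ) 1, gaussMap a x ∈ gaussMap b '' B → a = b ∧ x ∈ B := by
    rintro a x hx ⟨z, hz, hxz⟩
    refine ⟨?_, ?_⟩
    · rw [← digit_gaussMap a hx, ← hxz, digit_gaussMap b (hB' hz)]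
    · rwa [← gaussT_gaussMap a hx, ← hxz, gaussT_gaussMap b (hB' hz)]
  rw [hμ.2.2 _ hsub hm, tsum_eq_single (⟨b, hb⟩ : primes)]
  · have h1 : (gaussMap b ⁻¹' (gaussMap b '' B) : Set ℝ) =ᵐ[μ] B := by
      filter_upwards [hIoo] with x hx
      exact propext ⟨fun h => (hpre b x hx h).2, fun h => ⟨x, h, rfl⟩⟩
    rw [Measure.restrict_congr_set h1, setIntegral_congr_fun hB
      (fun x hx => abs_deriv_gaussMap_rpow (hB' hx).1 δ),
      ofReal_integral_eq_lintegral_ofReal]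
    · refine Integrable.of_bound (C := 1) ?_ ?_
      · exact (by fun_prop : Measurable fun x : ℝ => ((b : ℝ) + x) ^ (-(2 * δ))).aestronglyMeasurable
      · filter_upwards [ae_restrict_mem hB] with x hx
        have h1 : (2 : ℝ) ≤ b := by exact_mod_cast hb.two_le
        have h2 := (hB' hx).1
        rw [Real.norm_of_nonneg (by positivity)]
        exact Real.rpow_le_one_of_one_le_of_nonpos (by linarith) (by linarith)
    · filter_upwards [ae_restrict_mem hB] with x hx
      have h2 := (hB' hx).1
      simp only [Pi.zero_apply]
      positivity
  · rintro ⟨a, ha⟩ hab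
    have h1 : (gaussMap a ⁻¹' (gaussMap b '' B) : Set ℝ) =ᵐ[μ] (∅ : Set ℝ) := by
      filter_upwards [hIoo] with x hx
      exact propext ⟨fun h => hab (Subtype.ext (hpre a x hx h).1), fun h => h.elim⟩
    rw [Measure.restrict_congr_set h1]
    simp

lemma IsConformal.lintegral_gaussMap_image {δ : ℝ} (hδ : 0 < δ) {μ : Measure ℝ}
    (hμ : IsConformal primes δ μ) {b : ℕ} (hb : b.Prime) {B : Set ℝ} (hB : MeasurableSet B)
    (hB' : B ⊆ Ioo 0 1) {f : ℝ → ℝ≥0∞} (hf : Measurable f) :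
    ∫⁻ x in gaussMap b '' B, f x ∂μ =
      ∫⁻ x in B, ENNReal.ofReal (((b : ℝ) + x) ^ (-(2 * δ))) * f (gaussMap b x) ∂μ := by
  have hg : Measurable fun x : ℝ => ENNReal.ofReal (((b : ℝ) + x) ^ (-(2 * δ))) := by fun_prop
  have hres : μ.restrict (gaussMap b '' B) = ((μ.restrict B).withDensity
      fun x => ENNReal.ofReal (((b : ℝ) + x) ^ (-(2 * δ)))).map (gaussMap b) := by
    ext S hS
    have hS' := measurable_gaussMap b hS
    rw [Measure.restrict_apply hS, Measure.map_apply (measurable_gaussMap b) hS,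
      withDensity_apply _ hS', Measure.restrict_restrict hS', inter_comm S,
      ← image_inter_preimage, inter_comm B,
      hμ.measure_gaussMap_image hδ hb (hS'.inter hB) (inter_subset_right.trans hB')]
  rw [hres, lintegral_map hf (measurable_gaussMap b)]
  exact lintegral_withDensity_eq_lintegral_mul _ hg (hf.comp (measurable_gaussMap b))

lemma wordMap_cons_image (a : ℕ) (ω : List ℕ) (B : Set ℝ) :
    wordMap (a :: ω) '' B = gaussMap a '' (wordMap ω '' B) :=
  image_comp (gaussMap a) (wordMap ω) B

lemma two_le_of_prime {ω : List ℕ} (hω : ∀ a ∈ ω, a.Prime) : ∀ a ∈ ω, 2 ≤ a :=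
  fun a ha => (hω a ha).two_le

lemma wordMap_image_subset {ω : List ℕ} (hω : ∀ a ∈ ω, 2 ≤ a) {B : Set ℝ} (hB : B ⊆ Ioo 0 1) :
    wordMap ω '' B ⊆ Ioo 0 1 := by
  rintro _ ⟨x, hx, rfl⟩
  exact wordMap_mem_Ioo hω (hB hx)

lemma IsConformal.lintegral_wordMap_image {δ : ℝ} (hδ : 0 < δ) {μ : Measure ℝ}
    (hμ : IsConformal primes δ μ) {ω : List ℕ} (hω : ∀ a ∈ ω, a.Prime) {B : Set ℝ}
    (hB : MeasurableSet B) (hB' : B ⊆ Ioo 0 1) {f : ℝ → ℝ≥0∞} (hf : Measurable f) :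
    ∫⁻ x in wordMap ω '' B, f x ∂μ =
      ∫⁻ x in B, ENNReal.ofReal (den ω x ^ (-(2 * δ))) * f (wordMap ω x) ∂μ := by
  induction ω generalizing f with
  | nil =>
    have : wordMap [] '' B = B := image_id B
    rw [this]
    simp [den, wordMap]
  | cons a ω ih =>
    have hω' : ∀ b ∈ ω, b.Prime := fun b hb => hω b (List.mem_cons_of_mem _ hb)
    have ha := hω a (by simp)
    have h2 := two_le_of_prime hω'
    have hg : Measurable fun x : ℝ => ENNReal.ofReal (((a : ℝ) + x) ^ (-(2 * δ))) := by fun_prop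
    rw [wordMap_cons_image, hμ.lintegral_gaussMap_image hδ ha (measurableSet_wordMap_image h2 hB hB')
      (wordMap_image_subset h2 hB') hf,
      ih hω' (f := fun x => ENNReal.ofReal (((a : ℝ) + x) ^ (-(2 * δ))) * f (gaussMap a x))
        (hg.mul (hf.comp (measurable_gaussMap a)))]
    refine setLIntegral_congr_fun hB fun x hx => ?_
    have hx' := Ioo_subset_Icc_self (hB' hx)
    have h3 := den_pos h2 hx'
    have h4 := (wordMap_mem_Icc h2 hx').1
    simp only [den, wordMap]
    rw [Real.mul_rpow (by positivity) h3.le, ENNReal.ofReal_mul (by positivity), ← mul_assoc]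
    congr 1
    exact mul_comm _ _

lemma IsConformal.measure_wordMap_image {δ : ℝ} (hδ : 0 < δ) {μ : Measure ℝ}
    (hμ : IsConformal primes δ μ) {ω : List ℕ} (hω : ∀ a ∈ ω, a.Prime) {B : Set ℝ}
    (hB : MeasurableSet B) (hB' : B ⊆ Ioo 0 1) :
    μ (wordMap ω '' B) = ∫⁻ x in B, ENNReal.ofReal (den ω x ^ (-(2 * δ))) ∂μ := by
  simpa using hμ.lintegral_wordMap_image hδ hω hB hB' (f := fun _ => 1) measurable_const

lemma IsConformal.le_measure_wordMap_image {δ : ℝ} (hδ : 0 < δ) {μ : Measure ℝ}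
    (hμ : IsConformal primes δ μ) {ω : List ℕ} (hω : ∀ a ∈ ω, a.Prime) {B : Set ℝ}
    (hB : MeasurableSet B) (hB' : B ⊆ Ioo 0 1) {y : ℝ} (hy : y ∈ Icc (0 : ℝ) 1) :
    ENNReal.ofReal ((2 * den ω y) ^ (-(2 * δ))) * μ B ≤ μ (wordMap ω '' B) := by
  have h2 := two_le_of_prime hω
  rw [hμ.measure_wordMap_image hδ hω hB hB', ← setLIntegral_const]
  refine setLIntegral_mono_ae' hB (Eventually.of_forall fun x hx => ?_)
  have hx' := Ioo_subset_Icc_self (hB' hx)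
  exact ENNReal.ofReal_le_ofReal (Real.rpow_le_rpow_of_nonpos (den_pos h2 hx')
    (den_le_two_mul_den h2 hx' hy) (by linarith))

lemma IsConformal.measure_wordMap_image_le {δ : ℝ} (hδ : 0 < δ) {μ : Measure ℝ}
    (hμ : IsConformal primes δ μ) {ω : List ℕ} (hω : ∀ a ∈ ω, a.Prime) {B : Set ℝ}
    (hB : MeasurableSet B) (hB' : B ⊆ Ioo 0 1) {y : ℝ} (hy : y ∈ Icc (0 : ℝ) 1) :
    μ (wordMap ω '' B) ≤ ENNReal.ofReal ((den ω y / 2) ^ (-(2 * δ))) * μ B := by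
  have h2 := two_le_of_prime hω
  rw [hμ.measure_wordMap_image hδ hω hB hB', ← setLIntegral_const]
  refine setLIntegral_mono_ae' hB (Eventually.of_forall fun x hx => ?_)
  have hx' := Ioo_subset_Icc_self (hB' hx)
  have h3 := den_pos h2 hy
  exact ENNReal.ofReal_le_ofReal (Real.rpow_le_rpow_of_nonpos (by positivity)
    (by linarith [den_le_two_mul_den h2 hy hx']) (by linarith))

lemma IsConformal.le_measure_gaussMap_image {δ : ℝ} (hδ : 0 < δ) {μ : Measure ℝ}
    (hμ : IsConformal primes δ μ) {b : ℕ} (hb : b.Prime) :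
    ENNReal.ofReal (((b : ℝ) + 1) ^ (-(2 * δ))) ≤ μ (gaussMap b '' Ioo 0 1) := by
  rw [hμ.measure_gaussMap_image hδ hb measurableSet_Ioo subset_rfl]
  calc _ = ∫⁻ _ in Ioo (0 : ℝ) 1, ENNReal.ofReal (((b : ℝ) + 1) ^ (-(2 * δ))) ∂μ := by
        rw [setLIntegral_const, hμ.measure_Ioo, mul_one]
    _ ≤ _ := by
        refine setLIntegral_mono_ae' measurableSet_Ioo (Eventually.of_forall fun x hx => ?_)
        have := hx.1
        exact ENNReal.ofReal_le_ofReal (Real.rpow_le_rpow_of_nonpos (by positivity)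
          (by linarith [hx.2]) (by linarith))

lemma IsConformal.measure_gaussMap_image_le {δ : ℝ} (hδ : 0 < δ) {μ : Measure ℝ}
    (hμ : IsConformal primes δ μ) {b : ℕ} (hb : b.Prime) :
    μ (gaussMap b '' Ioo 0 1) ≤ ENNReal.ofReal ((b : ℝ) ^ (-(2 * δ))) := by
  rw [hμ.measure_gaussMap_image hδ hb measurableSet_Ioo subset_rfl]
  have hb' : (0 : ℝ) < b := by exact_mod_cast hb.pos
  calc _ ≤ ∫⁻ _ in Ioo (0 : ℝ) 1, ENNReal.ofReal ((b : ℝ) ^ (-(2 * δ))) ∂μ := by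
        refine setLIntegral_mono_ae' measurableSet_Ioo (Eventually.of_forall fun x hx => ?_)
        exact ENNReal.ofReal_le_ofReal (Real.rpow_le_rpow_of_nonpos hb'
          (by linarith [hx.1]) (by linarith))
    _ = _ := by rw [setLIntegral_const, hμ.measure_Ioo, mul_one]

/-- The points of the prime Cantor set whose first `n` digits form the word `ω` and whose `n`th
iterate under the Gauss transformation lies in `B`. -/
def cylPart (n : ℕ) (ω : List ℕ) (B : Set ℝ) : Set ℝ :=
  {x | x ∈ primeCantor ∧ digits n x = ω ∧ gaussT^[n] x ∈ B}

lemma measurableSet_digits_eq (n : ℕ) (ω : List ℕ) : MeasurableSet {x | digits n x = ω} := by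
  induction n generalizing ω with
  | zero => simpa only [digits] using MeasurableSet.const ([] = ω)
  | succ n ih =>
    cases ω with
    | nil => simp [digits]
    | cons a ω =>
      simp only [digits, List.cons.injEq]
      exact (measurable_digit (measurableSet_singleton a)).inter (measurable_gaussT (ih ω))

lemma measurableSet_cylPart (n : ℕ) (ω : List ℕ) {B : Set ℝ} (hB : MeasurableSet B) :
    MeasurableSet (cylPart n ω B) :=
  measurableSet_primeCantor.inter
    ((measurableSet_digits_eq n ω).inter ((measurable_gaussT.iterate n) hB))

lemma digits_succ (n : ℕ) (x : ℝ) : digits (n + 1) x = digits n x ++ [digit (gaussT^[n] x)] := by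
  induction n generalizing x with
  | zero => rfl
  | succ n ih =>
    rw [digits, ih, digits, Function.iterate_succ_apply]
    rfl

lemma exists_of_mem_digits {n : ℕ} {x : ℝ} {a : ℕ} (h : a ∈ digits n x) :
    ∃ i < n, digit (gaussT^[i] x) = a := by
  induction n with
  | zero => simp [digits] at h
  | succ n ih =>
    rw [digits_succ, List.mem_append, List.mem_singleton] at h
    rcases h with h | rfl
    · obtain ⟨i, hi, rfl⟩ := ih h
      exact ⟨i, hi.trans n.lt_succ_self, rfl⟩
    · exact ⟨n, n.lt_succ_self, rfl⟩

lemma IsConformal.measure_cylPart {δ : ℝ} {μ : Measure ℝ} (hμ : IsConformal primes δ μ)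
    {ω : List ℕ} (hω : ∀ a ∈ ω, a.Prime) {B : Set ℝ} (hB' : B ⊆ Ioo 0 1) :
    μ (cylPart ω.length ω B) = μ (wordMap ω '' B) := by
  refine measure_congr ?_
  filter_upwards [hμ.ae_mem] with x hx
  refine propext ⟨fun h => ⟨_, h.2.2, ?_⟩, ?_⟩
  · have := wordMap_digits hx ω.length
    rwa [h.2.1] at this
  · rintro ⟨z, hz, rfl⟩
    obtain ⟨h1, h2⟩ := digits_wordMap (two_le_of_prime hω) (hB' hz)
    exact ⟨hx, h1, by rwa [h2]⟩

lemma four_rpow_le_sixteen {δ : ℝ} (hδ₂ : δ < 1) : (4 : ℝ) ^ (2 * δ) ≤ 16 :=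
  calc (4 : ℝ) ^ (2 * δ) ≤ 4 ^ (2 : ℝ) := Real.rpow_le_rpow_of_exponent_le (by norm_num) (by linarith)
    _ = 16 := by norm_num

lemma IsConformal.measure_cylPart_quasi {δ : ℝ} (hδ : 0 < δ) (hδ₂ : δ < 1) {μ : Measure ℝ}
    (hμ : IsConformal primes δ μ) (n : ℕ) (ω : List ℕ) {B : Set ℝ} (hB : MeasurableSet B)
    (hB' : B ⊆ Ioo 0 1) :
    μ (cylPart n ω B) ≤ 16 * μ B * μ (cylPart n ω (Ioo 0 1)) ∧
      μ B * μ (cylPart n ω (Ioo 0 1)) ≤ 16 * μ (cylPart n ω B) := by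
  rcases (cylPart n ω (Ioo 0 1)).eq_empty_or_nonempty with h | ⟨x, hx, rfl, -⟩
  · have h' : cylPart n ω B = ∅ :=
      subset_empty_iff.1 (h ▸ fun x hx => ⟨hx.1, hx.2.1, hB' hx.2.2⟩)
    simp [h, h']
  have hω := prime_of_mem_digits hx n
  have e1 := hμ.measure_cylPart hω hB'
  have e2 := hμ.measure_cylPart hω (subset_refl (Ioo (0 : ℝ) 1))
  rw [length_digits] at e1 e2
  rw [e1, e2]
  set ω := digits n x
  have hy : (1 / 2 : ℝ) ∈ Icc (0 : ℝ) 1 := by norm_num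
  have hd := den_pos (two_le_of_prime hω) hy
  have key : ENNReal.ofReal ((den ω (1 / 2) / 2) ^ (-(2 * δ))) ≤
      16 * ENNReal.ofReal ((2 * den ω (1 / 2)) ^ (-(2 * δ))) := by
    have h : den ω (1 / 2) / 2 = 4⁻¹ * (2 * den ω (1 / 2)) := by ring
    rw [h, Real.mul_rpow (by norm_num) (by positivity), ENNReal.ofReal_mul (by positivity),
      Real.inv_rpow (by norm_num), ← Real.rpow_neg (by norm_num), neg_neg]
    gcongr
    exact (ENNReal.ofReal_le_ofReal (four_rpow_le_sixteen hδ₂)).trans (by norm_num)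
  have l1 := hμ.le_measure_wordMap_image hδ hω hB hB' hy
  have u1 := hμ.measure_wordMap_image_le hδ hω hB hB' hy
  have l2 := hμ.le_measure_wordMap_image hδ hω measurableSet_Ioo subset_rfl hy
  have u2 := hμ.measure_wordMap_image_le hδ hω measurableSet_Ioo subset_rfl hy
  rw [hμ.measure_Ioo, mul_one] at l2 u2
  constructor
  · calc _ ≤ _ := u1
      _ ≤ 16 * ENNReal.ofReal ((2 * den ω (1 / 2)) ^ (-(2 * δ))) * μ B := by gcongr
      _ = 16 * μ B * ENNReal.ofReal ((2 * den ω (1 / 2)) ^ (-(2 * δ))) := by ring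
      _ ≤ _ := by gcongr
  · calc _ ≤ μ B * (16 * ENNReal.ofReal ((2 * den ω (1 / 2)) ^ (-(2 * δ)))) := by
          gcongr; exact u2.trans key
      _ = 16 * (ENNReal.ofReal ((2 * den ω (1 / 2)) ^ (-(2 * δ))) * μ B) := by ring
      _ ≤ _ := by gcongr

lemma measure_digits_mem (μ : Measure ℝ) (n : ℕ) (W : Set (List ℕ)) {B : Set ℝ}
    (hB : MeasurableSet B) :
    MeasurableSet {x | x ∈ primeCantor ∧ digits n x ∈ W ∧ gaussT^[n] x ∈ B} ∧
    μ {x | x ∈ primeCantor ∧ digits n x ∈ W ∧ gaussT^[n] x ∈ B} =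
      ∑' ω : W, μ (cylPart n ω B) := by
  have h : {x | x ∈ primeCantor ∧ digits n x ∈ W ∧ gaussT^[n] x ∈ B} =
      ⋃ ω ∈ W, cylPart n ω B := by
    ext x
    simp only [cylPart, mem_iUnion, mem_ofPred_eq]
    exact ⟨fun h => ⟨_, h.2.1, h.1, rfl, h.2.2⟩, fun ⟨ω, hω, h1, h2, h3⟩ => ⟨h1, h2 ▸ hω, h3⟩⟩
  rw [h]
  refine ⟨MeasurableSet.biUnion W.to_countable fun ω _ => measurableSet_cylPart n ω hB,
    measure_biUnion W.to_countable ?_ fun ω _ => measurableSet_cylPart n ω hB⟩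
  intro ω _ τ _ hωτ
  refine Set.disjoint_left.2 fun x hx hx' => hωτ ?_
  rw [← hx.2.1, ← hx'.2.1]

lemma IsConformal.measure_digits_mem_quasi {δ : ℝ} (hδ : 0 < δ) (hδ₂ : δ < 1) {μ : Measure ℝ}
    (hμ : IsConformal primes δ μ) (n : ℕ) (W : Set (List ℕ)) {B : Set ℝ} (hB : MeasurableSet B)
    (hB' : B ⊆ Ioo 0 1) :
    μ {x | x ∈ primeCantor ∧ digits n x ∈ W ∧ gaussT^[n] x ∈ B} ≤
        16 * μ B * μ {x | x ∈ primeCantor ∧ digits n x ∈ W} ∧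
      μ B * μ {x | x ∈ primeCantor ∧ digits n x ∈ W} ≤
        16 * μ {x | x ∈ primeCantor ∧ digits n x ∈ W ∧ gaussT^[n] x ∈ B} := by
  have h : {x | x ∈ primeCantor ∧ digits n x ∈ W} =
      {x | x ∈ primeCantor ∧ digits n x ∈ W ∧ gaussT^[n] x ∈ Ioo (0 : ℝ) 1} := by
    ext x
    exact ⟨fun h => ⟨h.1, h.2, (h.1 n).1⟩, fun h => ⟨h.1, h.2.1⟩⟩
  rw [h, (measure_digits_mem μ n W hB).2, (measure_digits_mem μ n W measurableSet_Ioo).2,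
    ← ENNReal.tsum_mul_left, ← ENNReal.tsum_mul_left, ← ENNReal.tsum_mul_left]
  exact ⟨ENNReal.tsum_le_tsum fun ω => (hμ.measure_cylPart_quasi hδ hδ₂ n ω hB hB').1,
    ENNReal.tsum_le_tsum fun ω => (hμ.measure_cylPart_quasi hδ hδ₂ n ω hB hB').2⟩

lemma le_digit {x : ℝ} (hx : 0 < x) {m : ℕ} (hm : 1 ≤ m) (hxm : x ≤ (m : ℝ)⁻¹) : m ≤ digit x := by
  have : (0 : ℝ) < m := by exact_mod_cast hm
  exact Nat.le_floor ((le_inv_comm₀ this hx).2 hxm)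

lemma IsConformal.exists_tail_le {δ : ℝ} (hδ₁ : 1 / 2 < δ) {μ : Measure ℝ}
    (hμ : IsConformal primes δ μ) :
    ∃ M : ℝ, 0 ≤ M ∧ ∀ m : ℕ, 1 ≤ m →
      μ (Ioc 0 (m : ℝ)⁻¹) ≤ ENNReal.ofReal (M * (m : ℝ) ^ (-((2 * δ - 1) / 2))) := by
  set s := (2 * δ - 1) / 2 with hs
  have hs0 : 0 < s := by rw [hs]; linarith
  have hsum : Summable fun b : ℕ => (b : ℝ) ^ (-(1 + s)) :=
    Real.summable_nat_rpow.2 (by linarith)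
  refine ⟨∑' b : ℕ, (b : ℝ) ^ (-(1 + s)), tsum_nonneg fun b => by positivity, fun m hm => ?_⟩
  have hm0 : (0 : ℝ) < m := by exact_mod_cast hm
  have hsub : Ioc 0 (m : ℝ)⁻¹ ≤ᵐ[μ]
      ⋃ b : ℕ, {x | (b.Prime ∧ m ≤ b) ∧ x ∈ gaussMap b '' Ioo 0 1} := by
    filter_upwards [hμ.ae_mem] with x hx hxm
    refine mem_iUnion.2 ⟨digit x, ⟨primeCantor_digit_prime hx, le_digit hxm.1 hm hxm.2⟩,
      gaussT x, primeCantor_mem_Ioo (gaussT_mem_primeCantor hx), gaussMap_digit hxm.1⟩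
  have hb : ∀ b : ℕ, μ {x | (b.Prime ∧ m ≤ b) ∧ x ∈ gaussMap b '' Ioo 0 1} ≤
      ENNReal.ofReal ((b : ℝ) ^ (-(1 + s)) * (m : ℝ) ^ (-s)) := by
    intro b
    by_cases h : b.Prime ∧ m ≤ b
    · have hmb : (m : ℝ) ≤ b := by exact_mod_cast h.2
      simp only [h, true_and, and_self, ofPred_mem_eq]
      refine (hμ.measure_gaussMap_image_le (by linarith) h.1).trans (ENNReal.ofReal_le_ofReal ?_)
      rw [show -(2 * δ) = -(1 + s) + -s by rw [hs]; ring, Real.rpow_add (by linarith)]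
      exact mul_le_mul_of_nonneg_left
        (Real.rpow_le_rpow_of_nonpos hm0 hmb (by linarith)) (by positivity)
    · simp [h]
  calc _ ≤ _ := measure_mono_ae hsub
    _ ≤ _ := measure_iUnion_le _
    _ ≤ _ := ENNReal.tsum_le_tsum hb
    _ = _ := by
      rw [← ENNReal.ofReal_tsum_of_nonneg (fun b => by positivity) (hsum.mul_right _),
        tsum_mul_right]

lemma IsConformal.exists_ae_eventually_lt {δ : ℝ} (hδ₁ : 1 / 2 < δ) (hδ₂ : δ < 1) {μ : Measure ℝ}
    (hμ : IsConformal primes δ μ) :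
    ∃ k : ℕ, ∀ᵐ x ∂μ, ∀ᶠ n : ℕ in atTop, (((n : ℝ) + 1) ^ k)⁻¹ < gaussT^[n] x := by
  obtain ⟨M, hM, hM'⟩ := hμ.exists_tail_le hδ₁
  set s := (2 * δ - 1) / 2 with hs
  have hs0 : 0 < s := by rw [hs]; linarith
  obtain ⟨k, hk⟩ := exists_nat_ge (2 / s)
  rw [div_le_iff₀ hs0] at hk
  have := hμ.1
  refine ⟨k, ?_⟩
  let B : ℕ → Set ℝ := fun n => Ioc 0 (((n : ℝ) + 1) ^ k)⁻¹ ∩ Ioo 0 1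
  let S : ℕ → Set ℝ := fun n => {x | x ∈ primeCantor ∧ digits n x ∈ univ ∧ gaussT^[n] x ∈ B n}
  have hS : ∀ n, μ (S n) ≤ ENNReal.ofReal (16 * M * (((n + 1 : ℕ) : ℝ) ^ 2)⁻¹) := by
    intro n
    have hn : (1 : ℝ) ≤ ((n + 1 : ℕ) : ℝ) := by exact_mod_cast Nat.le_add_left 1 n
    have h1 := (hμ.measure_digits_mem_quasi (by linarith) hδ₂ n univ (B := B n)
      (measurableSet_Ioc.inter measurableSet_Ioo) inter_subset_right).1
    have h2 : μ (B n) ≤ ENNReal.ofReal (M * (((n + 1 : ℕ) : ℝ) ^ 2)⁻¹) := by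
      refine (measure_mono inter_subset_left).trans ?_
      have h3 := hM' ((n + 1) ^ k) (Nat.one_le_pow _ _ n.succ_pos)
      push_cast at h3 hn ⊢
      refine h3.trans (ENNReal.ofReal_le_ofReal (mul_le_mul_of_nonneg_left ?_ hM))
      rw [← Real.rpow_natCast, ← Real.rpow_natCast, ← Real.rpow_mul (by linarith),
        ← Real.rpow_neg (by linarith)]
      exact Real.rpow_le_rpow_of_exponent_le hn (by push_cast; linarith)
    calc μ (S n) ≤ 16 * μ (B n) * 1 := h1.trans (by gcongr; exact prob_le_one)
      _ ≤ 16 * ENNReal.ofReal (M * (((n + 1 : ℕ) : ℝ) ^ 2)⁻¹) := by rw [mul_one]; gcongr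
      _ = _ := by
        rw [mul_assoc 16 M, ENNReal.ofReal_mul (p := 16) (by norm_num), ENNReal.ofReal_ofNat]
  have hfin : ∑' n, μ (S n) ≠ ∞ := by
    refine ne_top_of_le_ne_top ?_ (ENNReal.tsum_le_tsum hS)
    refine (Summable.mul_left _ ?_).tsum_ofReal_ne_top
    exact (summable_nat_add_iff 1).2 (Real.summable_nat_pow_inv.2 one_lt_two)
  filter_upwards [ae_eventually_notMem hfin, hμ.ae_mem] with x hx hxp
  filter_upwards [hx] with n hn
  by_contra h
  exact hn ⟨hxp, mem_univ _, ⟨(hxp n).1.1, not_lt.1 h⟩, (hxp n).1⟩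

lemma IsConformal.measure_not_mem_digits_le {δ : ℝ} (hδ : 0 < δ) (hδ₂ : δ < 1) {μ : Measure ℝ}
    (hμ : IsConformal primes δ μ) {q : ℕ} (hq : q.Prime) (n : ℕ) :
    μ.real {x | x ∈ primeCantor ∧ q ∉ digits n x} ≤ (1 - (((q : ℝ) + 1) ^ 2)⁻¹ / 16) ^ n := by
  have := hμ.1
  have hη : (((q : ℝ) + 1) ^ 2)⁻¹ ≤ μ.real (gaussMap q '' Ioo 0 1) := by
    refine (ENNReal.ofReal_le_iff_le_toReal (measure_ne_top _ _)).1
      ((ENNReal.ofReal_le_ofReal ?_).trans (hμ.le_measure_gaussMap_image hδ hq))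
    rw [← Real.rpow_natCast, ← Real.rpow_neg (by positivity)]
    exact Real.rpow_le_rpow_of_exponent_le (by linarith [(Nat.cast_nonneg q : (0 : ℝ) ≤ q)])
      (by push_cast; linarith)
  have hle : (((q : ℝ) + 1) ^ 2)⁻¹ ≤ 1 := hη.trans measureReal_le_one
  induction n with
  | zero => simp [measureReal_le_one]
  | succ n ih =>
    have hmB : MeasurableSet (gaussMap q '' Ioo 0 1) :=
      measurableSet_wordMap_image (ω := [q]) (by simpa using hq.two_le) measurableSet_Ioo subset_rfl
    have hsB : gaussMap q '' Ioo 0 1 ⊆ Ioo 0 1 :=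
      wordMap_image_subset (ω := [q]) (by simpa using hq.two_le) subset_rfl
    have h1 := (hμ.measure_digits_mem_quasi hδ hδ₂ n {ω | q ∉ ω} hmB hsB).2
    have hmeas := (measure_digits_mem μ n {ω | q ∉ ω} hmB).1
    set A := {x | x ∈ primeCantor ∧ digits n x ∈ {ω : List ℕ | q ∉ ω} ∧
      gaussT^[n] x ∈ gaussMap q '' Ioo 0 1} with hA
    have h2 : μ.real (gaussMap q '' Ioo 0 1) * μ.real {x | x ∈ primeCantor ∧ q ∉ digits n x} ≤
        16 * μ.real A := by
      have := ENNReal.toReal_mono (ENNReal.mul_ne_top (by norm_num) (measure_ne_top _ _)) h1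
      simpa [ENNReal.toReal_mul, measureReal_def] using this
    have h3 : μ.real {x | x ∈ primeCantor ∧ q ∉ digits (n + 1) x} + μ.real A ≤
        μ.real {x | x ∈ primeCantor ∧ q ∉ digits n x} := by
      rw [← measureReal_union ?_ hmeas]
      · refine measureReal_mono ?_
        rintro x (hx | hx)
        · refine ⟨hx.1, fun h => hx.2 ?_⟩
          rw [digits_succ]
          exact List.mem_append_left _ h
        · exact ⟨hx.1, hx.2.1⟩
      · refine Set.disjoint_left.2 fun x hx hx' => hx.2 ?_
        obtain ⟨z, hz, hzx⟩ := hx'.2.2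
        rw [digits_succ, ← hzx, digit_gaussMap q hz]
        simp
    have h0 : 0 ≤ μ.real {x | x ∈ primeCantor ∧ q ∉ digits n x} := measureReal_nonneg
    have h4 := mul_le_mul_of_nonneg_right hη h0
    rw [pow_succ]
    have h5 : μ.real {x | x ∈ primeCantor ∧ q ∉ digits (n + 1) x} ≤
        μ.real {x | x ∈ primeCantor ∧ q ∉ digits n x} * (1 - (((q : ℝ) + 1) ^ 2)⁻¹ / 16) := by
      linarith
    exact h5.trans (mul_le_mul_of_nonneg_right ih (by linarith))

lemma IsConformal.ae_frequently_mem_digits {δ : ℝ} (hδ : 0 < δ) (hδ₂ : δ < 1) {μ : Measure ℝ}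
    (hμ : IsConformal primes δ μ) {Q : Set ℕ} (hQ : ∀ q ∈ Q, q.Prime)
    (hQ' : ∀ N : ℕ, ∃ q ∈ Q, N ≤ q) :
    ∀ᵐ x ∂μ, ∀ N : ℕ, ∃ q ∈ Q, N ≤ q ∧ q ∈ digits (q ^ 3) x := by
  have := hμ.1
  rw [ae_all_iff]
  intro N
  have hb : ∀ q ∈ Q, N ≤ q →
      μ.real {x | x ∈ primeCantor ∧ ∀ q ∈ Q, N ≤ q → q ∉ digits (q ^ 3) x} ≤
        Real.exp (-((q : ℝ) / 64)) := by
    intro q hq hNq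
    have hq0 : (1 : ℝ) ≤ q := by exact_mod_cast (hQ q hq).one_le
    calc _ ≤ μ.real {x | x ∈ primeCantor ∧ q ∉ digits (q ^ 3) x} :=
          measureReal_mono fun x hx => ⟨hx.1, hx.2 q hq hNq⟩
      _ ≤ _ := hμ.measure_not_mem_digits_le hδ hδ₂ (hQ q hq) _
      _ ≤ Real.exp (-((((q : ℝ) + 1) ^ 2)⁻¹ / 16)) ^ (q ^ 3) := by
          refine pow_le_pow_left₀ ?_ (by linarith [Real.add_one_le_exp (-((((q : ℝ) + 1) ^ 2)⁻¹ / 16))]) _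
          have : (((q : ℝ) + 1) ^ 2)⁻¹ ≤ 1 := inv_le_one_of_one_le₀ (by nlinarith)
          linarith
      _ ≤ _ := by
          rw [← Real.exp_nat_mul, Real.exp_le_exp]
          have : (q : ℝ) / 4 ≤ (q : ℝ) ^ 3 * (((q : ℝ) + 1) ^ 2)⁻¹ := by
            rw [← div_eq_mul_inv, div_le_div_iff₀ (by norm_num) (by positivity)]
            nlinarith [mul_nonneg (by linarith : (0 : ℝ) ≤ q) (by linarith : (0 : ℝ) ≤ (q : ℝ) - 1),
              mul_nonneg (mul_nonneg (by linarith : (0 : ℝ) ≤ q)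
                (by linarith : (0 : ℝ) ≤ (q : ℝ) - 1)) (by linarith : (0 : ℝ) ≤ 3 * (q : ℝ) + 1)]
          push_cast
          linarith
  have hlim : Tendsto (fun q : ℕ => Real.exp (-((q : ℝ) / 64))) atTop (𝓝 0) :=
    Real.tendsto_exp_neg_atTop_nhds_zero.comp
      (tendsto_natCast_atTop_atTop.atTop_div_const (by norm_num))
  have hzero : μ.real {x | x ∈ primeCantor ∧ ∀ q ∈ Q, N ≤ q → q ∉ digits (q ^ 3) x} ≤ 0 := by
    refine le_of_forall_pos_le_add fun ε hε => ?_
    obtain ⟨m, hm⟩ := eventually_atTop.1 (hlim.eventually_lt_const hε)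
    obtain ⟨q, hq, hmq⟩ := hQ' (max m N)
    rw [zero_add]
    exact (hb q hq (le_of_max_le_right hmq)).trans (hm q (le_of_max_le_left hmq)).le
  have hnull := (measureReal_eq_zero_iff (measure_ne_top _ _)).1 (hzero.antisymm measureReal_nonneg)
  filter_upwards [hμ.ae_mem, measure_eq_zero_iff_ae_notMem.1 hnull] with x hx hx'
  by_contra! h
  exact hx' ⟨hx, h⟩

lemma nth_prime_prime (n : ℕ) : (Nat.nth Nat.Prime n).Prime :=
  Nat.nth_mem_of_infinite Nat.infinite_setOfPred_prime n

lemma nth_prime_strictMono : StrictMono (Nat.nth Nat.Prime) :=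
  Nat.nth_strictMono Nat.infinite_setOfPred_prime

lemma exists_nth_prime_eq {b : ℕ} (hb : b.Prime) : ∃ m, Nat.nth Nat.Prime m = b :=
  ⟨_, Nat.nth_count hb⟩

lemma nth_prime_succ_le (n : ℕ) : Nat.nth Nat.Prime (n + 1) ≤ 2 * Nat.nth Nat.Prime n := by
  obtain ⟨b, hb, h1, h2⟩ := Nat.exists_prime_lt_and_le_two_mul _ (nth_prime_prime n).ne_zero
  obtain ⟨m, rfl⟩ := exists_nth_prime_eq hb
  exact (nth_prime_strictMono.monotone (nth_prime_strictMono.lt_iff_lt.1 h1)).trans h2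

/-- If the prime gaps are `O(log²)`, then every interval `(X, X + G log² X]` contains a prime. -/
lemma exists_prime_gap_le
    (h : limsup (fun n : ℕ => ENNReal.ofReal
      (((Nat.nth Nat.Prime (n + 1 + 1) - Nat.nth Nat.Prime (n + 1) : ℕ) : ℝ) /
        Real.log (Nat.nth Nat.Prime n) ^ 2)) atTop < ⊤) :
    ∃ G : ℝ, 1 ≤ G ∧ ∀ X : ℝ, 2 ≤ X →
      ∃ b : ℕ, b.Prime ∧ X < b ∧ (b : ℝ) ≤ X + G * Real.log X ^ 2 := by
  obtain ⟨C, hC1, hC2⟩ := exists_between h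
  obtain ⟨n₀, hn₀⟩ := eventually_atTop.1 (eventually_lt_of_limsup_lt hC1)
  set P := Nat.nth Nat.Prime with hP
  have hl2 : 0 < Real.log 2 := Real.log_pos one_lt_two
  refine ⟨1 + (C.toReal + P (n₀ + 1) / Real.log 2 ^ 2), ?_, fun X hX => ?_⟩
  · have : 0 ≤ C.toReal + P (n₀ + 1) / Real.log 2 ^ 2 := by positivity
    linarith
  have hlX : Real.log 2 ≤ Real.log X := Real.log_le_log two_pos hX
  have hex : ∃ m, X < P m := by
    obtain ⟨N, hN⟩ := exists_nat_gt X
    exact ⟨N, hN.trans_le (by exact_mod_cast nth_prime_strictMono.le_apply)⟩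
  classical
  obtain ⟨m, hm, hmin⟩ : ∃ m, X < P m ∧ ∀ j < m, (P j : ℝ) ≤ X :=
    ⟨Nat.find hex, Nat.find_spec hex, fun j hj => not_lt.1 (Nat.find_min hex hj)⟩
  refine ⟨P m, nth_prime_prime m, hm, ?_⟩
  rcases le_or_gt m (n₀ + 1) with hle | hgt
  · have h1 : (P m : ℝ) ≤ P (n₀ + 1) := by exact_mod_cast nth_prime_strictMono.monotone hle
    have h2 : (P (n₀ + 1) : ℝ) ≤ P (n₀ + 1) / Real.log 2 ^ 2 * Real.log X ^ 2 := by
      rw [div_mul_eq_mul_div, le_div_iff₀ (by positivity)]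
      gcongr
    have h3 : 0 ≤ C.toReal * Real.log X ^ 2 := by positivity
    nlinarith [sq_nonneg (Real.log X)]
  · obtain ⟨n, rfl⟩ : ∃ n, m = n + 1 + 1 := ⟨m - 2, by omega⟩
    have h1 := hn₀ n (by omega)
    have hpn : (2 : ℝ) ≤ P n := by exact_mod_cast (nth_prime_prime n).two_le
    have hlp : 0 < Real.log (P n) := Real.log_pos (by linarith)
    have hle : P (n + 1) ≤ P (n + 1 + 1) := nth_prime_strictMono.monotone (Nat.le_succ _)
    have h2 : ((P (n + 1 + 1) - P (n + 1) : ℕ) : ℝ) ≤ C.toReal * Real.log (P n) ^ 2 := by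
      have := (ENNReal.ofReal_le_iff_le_toReal hC2.ne).1 h1.le
      rwa [div_le_iff₀ (by positivity)] at this
    rw [Nat.cast_sub hle] at h2
    have h3 : C.toReal * Real.log (P n) ^ 2 ≤ C.toReal * Real.log X ^ 2 := by
      have := hmin n (by omega)
      gcongr
    have h4 := hmin (n + 1) (by omega)
    have h5 : 0 ≤ P (n₀ + 1) / Real.log 2 ^ 2 * Real.log X ^ 2 := by positivity
    nlinarith [sq_nonneg (Real.log X)]

/-- If infinitely many primes are isolated at scale `log²`, they can be found arbitrarily far out. -/
lemma exists_isolated_prime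
    (h : 0 < limsup (fun n : ℕ => ENNReal.ofReal
      (min ((Nat.nth Nat.Prime (n + 1 + 1) - Nat.nth Nat.Prime (n + 1) : ℕ) : ℝ)
        ((Nat.nth Nat.Prime (n + 2 + 1) - Nat.nth Nat.Prime (n + 2) : ℕ) : ℝ) /
        Real.log (Nat.nth Nat.Prime n) ^ 2)) atTop) :
    ∃ c : ℝ, 0 < c ∧ ∀ N : ℕ, ∃ q : ℕ, q.Prime ∧ N ≤ q ∧
      ∀ b : ℕ, b.Prime → b ≠ q → c * Real.log q ^ 2 ≤ |(b : ℝ) - q| := by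
  obtain ⟨C, hC1, hC2⟩ := exists_between h
  have hfr := frequently_lt_of_lt_limsup (by isBoundedDefault) hC2
  set P := Nat.nth Nat.Prime with hP
  have hC : 0 < C.toReal := ENNReal.toReal_pos hC1.ne' (hC2.trans_le le_top).ne
  refine ⟨C.toReal / 9, by positivity, fun N => ?_⟩
  obtain ⟨n, hnN, hn⟩ := frequently_atTop.1 hfr N
  have hpn : (2 : ℝ) ≤ P n := by exact_mod_cast (nth_prime_prime n).two_le
  have hl2 : 0 < Real.log 2 := Real.log_pos one_lt_two
  have hlp : Real.log 2 ≤ Real.log (P n) := Real.log_le_log two_pos hpn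
  have hlp' : 0 < Real.log (P n) := by linarith
  have hq4 : P (n + 2) ≤ 4 * P n := by
    have h1 : P (n + 1) ≤ 2 * P n := nth_prime_succ_le n
    have h2 : P (n + 2) ≤ 2 * P (n + 1) := nth_prime_succ_le (n + 1)
    omega
  have hlq : Real.log (P (n + 2)) ≤ 3 * Real.log (P n) := by
    have hq0 : (0 : ℝ) < P (n + 2) := by exact_mod_cast (nth_prime_prime _).pos
    have h1 : Real.log (P (n + 2)) ≤ Real.log (2 ^ 2 * P n) :=
      Real.log_le_log hq0 (by norm_num; exact_mod_cast hq4)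
    rw [Real.log_mul (by norm_num) (by positivity), Real.log_pow] at h1
    push_cast at h1
    linarith
  have hlq0 : 0 ≤ Real.log (P (n + 2)) := Real.log_natCast_nonneg _
  have hmin : C.toReal / 9 * Real.log (P (n + 2)) ^ 2 ≤
      min ((P (n + 1 + 1) - P (n + 1) : ℕ) : ℝ) ((P (n + 2 + 1) - P (n + 2) : ℕ) : ℝ) := by
    have h1 : C.toReal ≤ min ((P (n + 1 + 1) - P (n + 1) : ℕ) : ℝ)
        ((P (n + 2 + 1) - P (n + 2) : ℕ) : ℝ) / Real.log (P n) ^ 2 :=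
      ENNReal.toReal_le_of_le_ofReal (by positivity) hn.le
    rw [le_div_iff₀ (by positivity)] at h1
    refine le_trans ?_ h1
    have h2 : Real.log (P (n + 2)) ^ 2 ≤ (3 * Real.log (P n)) ^ 2 := by gcongr
    nlinarith
  have hs1 : P (n + 1) ≤ P (n + 1 + 1) := nth_prime_strictMono.monotone (Nat.le_succ _)
  have hs2 : P (n + 2) ≤ P (n + 2 + 1) := nth_prime_strictMono.monotone (Nat.le_succ _)
  rw [Nat.cast_sub hs1, Nat.cast_sub hs2] at hmin
  refine ⟨P (n + 2), nth_prime_prime _, ?_, fun b hb hbq => ?_⟩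
  · have : n + 2 ≤ P (n + 2) := nth_prime_strictMono.le_apply
    omega
  obtain ⟨m, rfl⟩ := exists_nth_prime_eq hb
  rw [← hP] at hbq ⊢
  rcases lt_trichotomy m (n + 2) with hm | rfl | hm
  · have h1 : (P m : ℝ) ≤ P (n + 1) := by
      exact_mod_cast nth_prime_strictMono.monotone (show m ≤ n + 1 by omega)
    have h2 := hmin.trans (min_le_left _ _)
    rw [abs_sub_comm]
    exact (h2.trans (sub_le_sub_left h1 _)).trans (le_abs_self _)
  · exact absurd rfl hbq
  · have h1 : (P (n + 2 + 1) : ℝ) ≤ P m := by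
      exact_mod_cast nth_prime_strictMono.monotone (show n + 2 + 1 ≤ m by omega)
    have h2 := hmin.trans (min_le_right _ _)
    exact (h2.trans (sub_le_sub_right h1 _)).trans (le_abs_self _)

/-- Counting primes in `(A, A + K - 1]` through the gap bound. -/
lemma exists_finset_primes {G : ℝ} (hG : 0 < G) (hgap : ∀ X : ℝ, 2 ≤ X →
      ∃ b : ℕ, b.Prime ∧ X < b ∧ (b : ℝ) ≤ X + G * Real.log X ^ 2)
    {A K : ℝ} (hA : 2 ≤ A) (hK : 1 ≤ K) (hKA : K ≤ A) :
    ∃ S : Finset ℕ, (∀ b ∈ S, b.Prime ∧ A < b ∧ (b : ℝ) ≤ A + K - 1) ∧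
      (K - 1) / (4 * G * Real.log A ^ 2) - 1 ≤ S.card := by
  have hl2 : 0 < Real.log 2 := Real.log_pos one_lt_two
  have hlA : Real.log 2 ≤ Real.log A := Real.log_le_log two_pos hA
  set g := 4 * G * Real.log A ^ 2 with hg
  have hg0 : 0 < g := by have := hl2.trans_le hlA; positivity
  have hex : ∀ i : ℕ, ∃ b : ℕ, b.Prime ∧ A + i * g < b ∧
      (i < ⌊(K - 1) / g⌋₊ → (b : ℝ) ≤ A + (i + 1) * g) := by
    intro i
    obtain ⟨b, hb, h1, h2⟩ := hgap (A + i * g) (by nlinarith [mul_nonneg (Nat.cast_nonneg i) hg0.le])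
    refine ⟨b, hb, h1, fun hi => h2.trans ?_⟩
    have hiK : ((i : ℝ) + 1) * g ≤ K - 1 := by
      rw [← le_div_iff₀ hg0]
      have : ((i + 1 : ℕ) : ℝ) ≤ (K - 1) / g :=
        (Nat.le_floor_iff (div_nonneg (by linarith) hg0.le)).1 hi
      exact_mod_cast this
    have hlog : Real.log (A + i * g) ≤ 2 * Real.log A := by
      have hig : 0 ≤ (i : ℝ) * g := by positivity
      calc Real.log (A + i * g) ≤ Real.log (2 * A) :=
            Real.log_le_log (by linarith) (by linarith)
        _ = Real.log 2 + Real.log A := Real.log_mul (by norm_num) (by linarith)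
        _ ≤ _ := by linarith
    have hlog0 : 0 ≤ Real.log (A + i * g) :=
      Real.log_nonneg (by linarith [mul_nonneg (Nat.cast_nonneg i) hg0.le])
    have : G * Real.log (A + i * g) ^ 2 ≤ g := by
      have : Real.log (A + i * g) ^ 2 ≤ (2 * Real.log A) ^ 2 := by gcongr
      rw [hg]
      nlinarith
    linarith
  choose f hf1 hf2 hf3 using hex
  have hinj : Set.InjOn f (Finset.range ⌊(K - 1) / g⌋₊) := by
    have key : ∀ i j : ℕ, j < ⌊(K - 1) / g⌋₊ → j < i → f j < f i := by
      intro i j hj hij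
      have h1 := hf3 j hj
      have h2 := hf2 i
      have h3 : ((j : ℝ) + 1) ≤ i := by exact_mod_cast hij
      have : (f j : ℝ) < f i := by nlinarith
      exact_mod_cast this
    intro i hi j hj hij
    rw [Finset.mem_coe, Finset.mem_range] at hi hj
    by_contra hne
    rcases lt_or_gt_of_ne hne with h | h
    · exact (key j i hi h).ne hij
    · exact (key i j hj h).ne' hij
  refine ⟨(Finset.range ⌊(K - 1) / g⌋₊).image f, ?_, ?_⟩
  · intro b hb
    obtain ⟨i, hi, rfl⟩ := Finset.mem_image.1 hb
    rw [Finset.mem_range] at hi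
    refine ⟨hf1 i, by nlinarith [hf2 i, mul_nonneg (Nat.cast_nonneg i) hg0.le], ?_⟩
    have hiK : ((i : ℝ) + 1) * g ≤ K - 1 := by
      rw [← le_div_iff₀ hg0]
      have : ((i + 1 : ℕ) : ℝ) ≤ (K - 1) / g :=
        (Nat.le_floor_iff (div_nonneg (by linarith) hg0.le)).1 hi
      exact_mod_cast this
    linarith [hf3 i hi]
  · rw [Finset.card_image_of_injOn hinj, Finset.card_range]
    linarith [Nat.lt_floor_add_one ((K - 1) / g)]

lemma IsConformal.card_mul_le_measure {δ : ℝ} (hδ : 0 < δ) {μ : Measure ℝ}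
    (hμ : IsConformal primes δ μ) {S : Finset ℕ} (hS : ∀ b ∈ S, b.Prime) {D : ℝ}
    (hD : ∀ b ∈ S, (b : ℝ) + 1 ≤ D) {T : Set ℝ} (hT : ∀ b ∈ S, gaussMap b '' Ioo 0 1 ⊆ T) :
    ENNReal.ofReal (S.card * D ^ (-(2 * δ))) ≤ μ T := by
  calc ENNReal.ofReal (S.card * D ^ (-(2 * δ)))
      = ∑ b ∈ S, ENNReal.ofReal (D ^ (-(2 * δ))) := by
        rw [Finset.sum_const, nsmul_eq_mul, ENNReal.ofReal_mul (by positivity),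
          ENNReal.ofReal_natCast]
    _ ≤ ∑ b ∈ S, μ (gaussMap b '' Ioo 0 1) := Finset.sum_le_sum fun b hb =>
        (ENNReal.ofReal_le_ofReal (Real.rpow_le_rpow_of_nonpos (by positivity) (hD b hb)
          (by linarith))).trans (hμ.le_measure_gaussMap_image hδ (hS b hb))
    _ = μ (⋃ b ∈ S, gaussMap b '' Ioo 0 1) := by
        refine (measure_biUnion_finset ?_ fun b hb => ?_).symm
        · intro a _ b _ hab
          refine Set.disjoint_left.2 ?_
          rintro _ ⟨x, hx, rfl⟩ ⟨z, hz, hzx⟩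
          exact hab (by rw [← digit_gaussMap a hx, ← hzx, digit_gaussMap b hz])
        · exact measurableSet_wordMap_image (ω := [b]) (by simpa using (hS b hb).two_le)
            measurableSet_Ioo subset_rfl
    _ ≤ μ T := measure_mono (iUnion₂_subset hT)

lemma IsConformal.le_measure_of_gap {δ : ℝ} (hδ : 0 < δ) (hδ₂ : δ < 1) {μ : Measure ℝ}
    (hμ : IsConformal primes δ μ) {G : ℝ} (hG : 1 ≤ G) (hgap : ∀ X : ℝ, 2 ≤ X →
      ∃ b : ℕ, b.Prime ∧ X < b ∧ (b : ℝ) ≤ X + G * Real.log X ^ 2)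
    {A K : ℝ} (hA : 2 ≤ A) (hK : 1 ≤ K) (hKA : K ≤ A) {T : Set ℝ} {e : ℕ} (he : e.Prime)
    (heA : (e : ℝ) + 1 ≤ 3 * A) (heT : gaussMap e '' Ioo 0 1 ⊆ T)
    (hT : ∀ b : ℕ, b.Prime → A < b → (b : ℝ) ≤ A + K - 1 → gaussMap b '' Ioo 0 1 ⊆ T) :
    ENNReal.ofReal ((K / (A * Real.log A) ^ 2 / (108 * G)) ^ δ) ≤ μ T := by
  obtain ⟨S, hS, hcard⟩ := exists_finset_primes (by linarith) hgap hA hK hKA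
  have hlA : 0.69 ≤ Real.log A :=
    (by linarith [Real.log_two_gt_d9] : (0.69 : ℝ) ≤ Real.log 2).trans
      (Real.log_le_log two_pos hA)
  have hA0 : 0 < A := by linarith
  set g := 4 * G * Real.log A ^ 2 with hg
  have hg1 : 1 ≤ g := by nlinarith
  have hcard' : (S.card : ℝ) ≤ (insert e S).card := by
    exact_mod_cast Finset.card_le_card (Finset.subset_insert e S)
  have hcard1 : (1 : ℝ) ≤ (insert e S).card := by
    exact_mod_cast Finset.card_pos.2 (Finset.insert_nonempty e S)
  have hu : K / (3 * g) ≤ (insert e S).card := by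
    have h1 : 1 / g ≤ 1 := by rw [div_le_one (by linarith)]; exact hg1
    have h2 : K / (3 * g) = ((K - 1) / g + 1 / g) / 3 := by field_simp; ring
    rw [h2]
    linarith
  have hpow : (K / (3 * g)) ^ δ ≤ (insert e S).card := by
    have h0 : 0 ≤ K / (3 * g) := div_nonneg (by linarith) (by linarith)
    rcases le_total (K / (3 * g)) 1 with h | h
    · exact (Real.rpow_le_one h0 h hδ.le).trans hcard1
    · exact ((Real.rpow_le_rpow_of_exponent_le h hδ₂.le).trans_eq (Real.rpow_one _)).trans hu
  refine le_trans (ENNReal.ofReal_le_ofReal ?_)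
    (hμ.card_mul_le_measure hδ (S := insert e S) (D := 3 * A) (T := T) ?_ ?_ ?_)
  · have h1 : K / (A * Real.log A) ^ 2 / (108 * G) = K / (3 * g) * ((3 * A) ^ 2)⁻¹ := by
      rw [hg]; field_simp; norm_num
    have h2 : (3 * A) ^ (-(2 * δ)) = (((3 * A) ^ 2)⁻¹) ^ δ := by
      rw [← Real.rpow_natCast, ← Real.rpow_neg (by positivity), ← Real.rpow_mul (by positivity)]
      norm_num
    rw [h1, h2, Real.mul_rpow (by positivity) (by positivity)]
    gcongr
  · simp only [Finset.mem_insert, forall_eq_or_imp]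
    exact ⟨he, fun b hb => (hS b hb).1⟩
  · simp only [Finset.mem_insert, forall_eq_or_imp]
    exact ⟨heA, fun b hb => by linarith [(hS b hb).2.2]⟩
  · simp only [Finset.mem_insert, forall_eq_or_imp]
    exact ⟨heT, fun b hb => hT b (hS b hb).1 (hS b hb).2.1 (hS b hb).2.2⟩

lemma IsConformal.le_measure_closedBall {δ : ℝ} (hδ : 0 < δ) (hδ₂ : δ < 1) {μ : Measure ℝ}
    (hμ : IsConformal primes δ μ) {G : ℝ} (hG : 1 ≤ G) (hgap : ∀ X : ℝ, 2 ≤ X →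
      ∃ b : ℕ, b.Prime ∧ X < b ∧ (b : ℝ) ≤ X + G * Real.log X ^ 2)
    {y ρ : ℝ} (hy : y ∈ primeCantor) (hyρ : 2 * y ^ 2 ≤ ρ) (hρ : ρ ≤ 2) :
    ENNReal.ofReal ((ρ / Real.log y⁻¹ ^ 2 / (432 * G)) ^ δ) ≤ μ (closedBall y ρ) := by
  have hy0 := (primeCantor_mem_Ioo hy).1
  have hy2 := primeCantor_le_half hy
  have hA : 2 ≤ y⁻¹ := by
    rw [le_inv_comm₀ two_pos hy0]; linarith
  have hρ0 : 0 < ρ := lt_of_lt_of_le (by positivity) hyρ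
  have hlog : ∀ X : ℝ, 2 ≤ X → 0 < Real.log X := fun X hX => Real.log_pos (by linarith)
  rcases le_total ρ y with h | h
  · have hpr := primeCantor_digit_prime hy
    have hT := primeCantor_mem_Ioo (gaussT_mem_primeCantor hy)
    have hyd : y⁻¹ = digit y + gaussT y := by
      have := gaussMap_digit hy0
      rw [gaussMap, one_div] at this
      rw [← this, inv_inv, this]
    refine le_trans (ENNReal.ofReal_le_ofReal ?_) (hμ.le_measure_of_gap hδ hδ₂ hG hgap
      (A := y⁻¹) (K := ρ * y⁻¹ ^ 2) hA ?_ ?_ hpr ?_ ?_ ?_)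
    · refine Real.rpow_le_rpow (by positivity) ?_ hδ.le
      have := hlog _ hA
      have h1 : ρ * y⁻¹ ^ 2 / (y⁻¹ * Real.log y⁻¹) ^ 2 = ρ / Real.log y⁻¹ ^ 2 := by
        field_simp
      rw [h1]
      gcongr
      norm_num
    · rw [inv_pow, ← div_eq_mul_inv, le_div_iff₀ (by positivity)]; linarith
    · rw [pow_two, ← mul_assoc]
      have : ρ * y⁻¹ ≤ 1 := by rw [← div_eq_mul_inv, div_le_one hy0]; exact h
      nlinarith
    · linarith [hT.1]
    · rintro _ ⟨z, hz, rfl⟩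
      have ha : (2 : ℝ) ≤ digit y := by exact_mod_cast hpr.two_le
      have h0 : (0 : ℝ) < digit y + z := by linarith [hz.1]
      have hyA : y * (digit y + gaussT y) = 1 := by rw [← hyd]; field_simp
      have h1 : gaussMap (digit y) z - y = y * gaussMap (digit y) z * (gaussT y - z) := by
        rw [gaussMap]
        field_simp
        linear_combination -hyA
      have h2 : gaussMap (digit y) z ≤ 2 * y := by
        rw [gaussMap, div_le_iff₀ h0]
        nlinarith [hT.2, hz.1]
      have h3 : 0 < gaussMap (digit y) z := by rw [gaussMap]; positivity
      have h4 : |gaussT y - z| ≤ 1 := abs_le.2 ⟨by linarith [hT.1, hz.2], by linarith [hT.2, hz.1]⟩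
      rw [mem_closedBall, Real.dist_eq, h1, abs_mul, abs_of_pos (mul_pos hy0 h3)]
      calc y * gaussMap (digit y) z * |gaussT y - z| ≤ y * (2 * y) * 1 := by gcongr
        _ ≤ ρ := by linarith
    · intro b hb hb1 hb2
      rintro _ ⟨z, hz, rfl⟩
      have h0 : (0 : ℝ) < b + z := by linarith [hz.1]
      have h1 : 1 / ((b : ℝ) + z) ≤ y := by
        rw [one_div]
        exact inv_le_of_inv_le₀ hy0 (by linarith [hz.1])
      have h2 : y - 1 / ((b : ℝ) + z) = y * (b + z - y⁻¹) * (1 / (b + z)) := by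
        field_simp
      rw [mem_closedBall, Real.dist_eq, gaussMap, abs_sub_comm, abs_of_nonneg (by linarith), h2]
      calc y * (b + z - y⁻¹) * (1 / (b + z)) ≤ y * (ρ * y⁻¹ ^ 2) * y := by
            gcongr
            linarith [hz.2]
        _ = ρ := by field_simp
  · set X := max 2 ρ⁻¹ with hX
    have hX2 : 2 ≤ X := le_max_left _ _
    have hXρ : ρ⁻¹ ≤ X := le_max_right _ _
    have hXA : X ≤ y⁻¹ := max_le hA (inv_anti₀ hy0 h)
    have hXρ2 : X ≤ 4 * ρ⁻¹ := max_le (by rw [← div_eq_mul_inv, le_div_iff₀ hρ0]; linarith)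
      (by linarith [inv_pos.2 hρ0])
    have hsub : ∀ b : ℕ, X < b → gaussMap b '' Ioo 0 1 ⊆ closedBall y ρ := by
      rintro b hb _ ⟨z, hz, rfl⟩
      have h1 : gaussMap b z ≤ ρ := by
        rw [gaussMap, one_div]
        refine inv_le_of_inv_le₀ hρ0 ?_
        linarith [hz.1]
      have h2 : 0 < gaussMap b z := by
        rw [gaussMap]; have := hz.1; positivity
      rw [mem_closedBall, Real.dist_eq, abs_le]
      constructor <;> linarith
    obtain ⟨e, he, he1, he2⟩ := Nat.exists_prime_lt_and_le_two_mul ⌊X⌋₊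
      (Nat.floor_pos.2 (by linarith)).ne'
    have he3 : X < e := (Nat.floor_lt (by linarith)).1 he1
    have he4 : (e : ℝ) ≤ 2 * X := by
      have h1 : (e : ℝ) ≤ 2 * (⌊X⌋₊ : ℝ) := by exact_mod_cast he2
      linarith [Nat.floor_le (show 0 ≤ X by linarith)]
    refine le_trans (ENNReal.ofReal_le_ofReal ?_) (hμ.le_measure_of_gap hδ hδ₂ hG hgap
      (A := X) (K := X) hX2 (by linarith) le_rfl he (by linarith) (hsub e he3)
      fun b _ hb _ => hsub b hb)
    refine Real.rpow_le_rpow (by positivity) ?_ hδ.le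
    have hlX := hlog X hX2
    have h1 : X / (X * Real.log X) ^ 2 = X⁻¹ / Real.log X ^ 2 := by
      field_simp
    have h2 : ρ / 4 ≤ X⁻¹ := by
      rw [le_inv_comm₀ (by positivity) (by linarith)]
      refine hXρ2.trans_eq ?_
      field_simp
    have h3 : ρ / Real.log y⁻¹ ^ 2 / (432 * G) = ρ / 4 / Real.log y⁻¹ ^ 2 / (108 * G) := by
      ring
    have h4 : Real.log X ≤ Real.log y⁻¹ := Real.log_le_log (by linarith) hXA
    rw [h1, h3]
    gcongr

lemma den_digits_succ {x : ℝ} (hx : x ∈ primeCantor) (n : ℕ) :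
    den (digits (n + 1) x) (gaussT^[n + 1] x) =
      den (digits n x) (gaussT^[n] x) * (gaussT^[n] x)⁻¹ := by
  rw [den_digits hx, den_digits hx, Finset.prod_range_succ]

lemma iterate_mem_Icc {x : ℝ} (hx : x ∈ primeCantor) (n : ℕ) :
    gaussT^[n] x ∈ Icc (0 : ℝ) 1 :=
  Ioo_subset_Icc_self (primeCantor_mem_Ioo (iterate_mem_primeCantor hx n))

lemma two_pow_le_den_digits {x : ℝ} (hx : x ∈ primeCantor) (n : ℕ) :
    2 ^ n ≤ den (digits n x) (gaussT^[n] x) := by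
  have := two_pow_le_den (two_le_of_prime (prime_of_mem_digits hx n)) (iterate_mem_Icc hx n)
  rwa [length_digits] at this

lemma IsConformal.le_measure_closedBall_of_den {δ : ℝ} (hδ : 0 < δ) (hδ₂ : δ < 1)
    {μ : Measure ℝ} (hμ : IsConformal primes δ μ) {G : ℝ} (hG : 1 ≤ G)
    (hgap : ∀ X : ℝ, 2 ≤ X → ∃ b : ℕ, b.Prime ∧ X < b ∧ (b : ℝ) ≤ X + G * Real.log X ^ 2)
    {x r : ℝ} (hx : x ∈ primeCantor) (hr : 0 < r) {n : ℕ}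
    (hn : den (digits n x) (gaussT^[n] x) ^ 2 * r ≤ 4)
    (hn' : 4 < den (digits (n + 1) x) (gaussT^[n + 1] x) ^ 2 * r) :
    ENNReal.ofReal ((r / Real.log (gaussT^[n] x)⁻¹ ^ 2 / (3456 * G)) ^ δ) ≤
      μ (closedBall x r) := by
  have hω := prime_of_mem_digits hx n
  have hω2 := two_le_of_prime hω
  have hy := iterate_mem_primeCantor hx n
  have hyI := iterate_mem_Icc hx n
  have hxy := wordMap_digits hx n
  rw [den_digits_succ hx] at hn'
  set y := gaussT^[n] x
  set ω := digits n x
  have hQ := den_pos hω2 hyI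
  have hy0 : 0 < y := (primeCantor_mem_Ioo hy).1
  set Q := den ω y with hQdef
  set ρ := r * Q ^ 2 / 2 with hρ
  have hyρ : 2 * y ^ 2 ≤ ρ := by
    have h1 : (Q * y⁻¹) ^ 2 * r * y ^ 2 = Q ^ 2 * r := by field_simp
    have h2 := mul_lt_mul_of_pos_right hn' (pow_pos hy0 2)
    rw [h1] at h2
    rw [hρ]
    linarith
  have hball := hμ.le_measure_closedBall hδ hδ₂ hG hgap hy hyρ (by rw [hρ]; linarith)
  have hB : MeasurableSet (closedBall y ρ ∩ Ioo 0 1) :=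
    measurableSet_closedBall.inter measurableSet_Ioo
  have hBμ : μ (closedBall y ρ ∩ Ioo 0 1) = μ (closedBall y ρ) :=
    measure_congr (inter_ae_eq_left_of_ae_eq_univ (by
      refine eventuallyEq_univ.2 ?_
      filter_upwards [hμ.ae_mem] with z hz using primeCantor_mem_Ioo hz))
  have hsub : wordMap ω '' (closedBall y ρ ∩ Ioo 0 1) ⊆ closedBall x r := by
    rintro _ ⟨z, ⟨hz, hz'⟩, rfl⟩
    have hz'' := Ioo_subset_Icc_self hz'
    have hd := den_le_two_mul_den hω2 hyI hz''
    rw [mem_closedBall, Real.dist_eq] at hz ⊢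
    rw [← hxy, abs_wordMap_sub_wordMap hω2 hz'' hyI, ← hQdef,
      div_le_iff₀ (mul_pos (den_pos hω2 hz'') hQ)]
    calc |z - y| ≤ r * Q ^ 2 / 2 := hz
      _ = r * (Q / 2 * Q) := by ring
      _ ≤ r * (den ω z * Q) := by gcongr; linarith
  refine le_trans ?_ (measure_mono hsub)
  refine le_trans ?_ (hμ.le_measure_wordMap_image hδ hω hB inter_subset_right hyI)
  rw [hBμ, ← hQdef]
  refine le_trans (le_of_eq ?_) (mul_le_mul_right hball _)
  rw [← ENNReal.ofReal_mul (by positivity)]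
  congr 1
  have h2 : (2 * Q) ^ (-(2 * δ)) = (((2 * Q) ^ 2)⁻¹) ^ δ := by
    rw [← Real.rpow_natCast, ← Real.rpow_neg (by positivity), ← Real.rpow_mul (by positivity)]
    norm_num
  rw [h2, ← Real.mul_rpow (by positivity) (by positivity), hρ]
  congr 1
  field_simp
  norm_num

lemma IsConformal.psi_le_measure_closedBall {δ : ℝ} (hδ : 0 < δ) (hδ₂ : δ < 1)
    {μ : Measure ℝ} (hμ : IsConformal primes δ μ) {G : ℝ} (hG : 1 ≤ G)
    (hgap : ∀ X : ℝ, 2 ≤ X → ∃ b : ℕ, b.Prime ∧ X < b ∧ (b : ℝ) ≤ X + G * Real.log X ^ 2)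
    {x r : ℝ} (hx : x ∈ primeCantor) (hr : 0 < r) {i k : ℕ} (hi : 9 ≤ i)
    (hik : ∀ n : ℕ, i ≤ n → (((n : ℝ) + 1) ^ k)⁻¹ < gaussT^[n] x)
    (hir : den (digits i x) (gaussT^[i] x) ^ 2 * r ≤ 4) :
    ENNReal.ofReal ((2 * r) ^ δ * Real.log (Real.log (1 / (2 * r))) ^ (-(2 * δ))) ≤
      ENNReal.ofReal ((6912 * G * (k + 1) ^ 2) ^ δ) * μ (closedBall x r) := by
  classical
  have hex : ∃ m, 4 < den (digits (i + m) x) (gaussT^[i + m] x) ^ 2 * r := by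
    obtain ⟨m, hm⟩ := pow_unbounded_of_one_lt (4 / r) (one_lt_two : (1 : ℝ) < 2)
    refine ⟨m, ?_⟩
    rw [div_lt_iff₀ hr] at hm
    refine hm.trans_le ?_
    gcongr
    have h1 := two_pow_le_den_digits hx (i + m)
    have h2 : (2 : ℝ) ^ m ≤ 2 ^ (i + m) := pow_le_pow_right₀ one_le_two (by omega)
    have h3 : (1 : ℝ) ≤ 2 ^ m := one_le_pow₀ one_le_two
    nlinarith
  obtain ⟨n, hin, hn, hn'⟩ : ∃ n, i ≤ n ∧ den (digits n x) (gaussT^[n] x) ^ 2 * r ≤ 4 ∧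
      4 < den (digits (n + 1) x) (gaussT^[n + 1] x) ^ 2 * r := by
    rcases hm : Nat.find hex with _ | m
    · have := Nat.find_spec hex
      rw [hm] at this
      exact absurd hir (not_le.2 this)
    · refine ⟨i + m, by omega, not_lt.1 (Nat.find_min hex (m := m) (by omega)), ?_⟩
      have := Nat.find_spec hex
      rwa [hm] at this
  refine le_trans ?_ (mul_le_mul_right
    (hμ.le_measure_closedBall_of_den hδ hδ₂ hG hgap hx hr hn hn') _)
  rw [← ENNReal.ofReal_mul (by positivity)]
  refine ENNReal.ofReal_le_ofReal ?_
  have hy := iterate_mem_primeCantor hx n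
  have hyk := hik n hin
  set y := gaussT^[n] x
  have hy0 : 0 < y := (primeCantor_mem_Ioo hy).1
  have hn1 : (0 : ℝ) < (n : ℝ) + 1 := by positivity
  have hL : 0 < Real.log y⁻¹ :=
    Real.log_pos ((one_lt_inv₀ hy0).2 (by linarith [primeCantor_le_half hy]))
  have hLn : Real.log y⁻¹ ≤ k * Real.log (n + 1) := by
    rw [← Real.log_pow]
    exact Real.log_le_log (by positivity) (inv_le_of_inv_le₀ (by positivity) hyk.le)
  have hlog : (n : ℝ) + 1 ≤ Real.log (1 / (2 * r)) := by
    have h9 : (9 : ℝ) ≤ n := by exact_mod_cast hi.trans hin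
    have h1 := two_pow_le_den_digits hx n
    have h2 : ((2 : ℝ) ^ n) ^ 2 * r ≤ 4 := le_trans (by gcongr) hn
    have h3 : (2 : ℝ) ^ n * 2 ^ n / 8 ≤ 1 / (2 * r) := by
      rw [le_div_iff₀ (by positivity)]
      linarith
    refine le_trans ?_ (Real.log_le_log (by positivity) h3)
    rw [Real.log_div (by positivity) (by norm_num),
      Real.log_mul (by positivity) (by positivity), Real.log_pow,
      show (8 : ℝ) = 2 ^ 3 by norm_num, Real.log_pow]
    have := Real.log_two_gt_d9
    push_cast
    nlinarith
  have hll : Real.log (n + 1) ≤ Real.log (Real.log (1 / (2 * r))) := Real.log_le_log hn1 hlog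
  have hn0 : 0 < Real.log ((n : ℝ) + 1) := Real.log_pos (by
    have : (9 : ℝ) ≤ n := by exact_mod_cast hi.trans hin
    linarith)
  set l := Real.log (Real.log (1 / (2 * r)))
  have hl : 0 < l := hn0.trans_le hll
  have hLl : Real.log y⁻¹ ≤ (k + 1) * l := by
    have : (k : ℝ) * Real.log (n + 1) ≤ k * l := by gcongr
    linarith
  have h2 : l ^ (-(2 * δ)) = ((l ^ 2)⁻¹) ^ δ := by
    rw [← Real.rpow_natCast, ← Real.rpow_neg (by positivity), ← Real.rpow_mul (by positivity)]
    norm_num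
  rw [h2, ← Real.mul_rpow (by positivity) (by positivity),
    ← Real.mul_rpow (by positivity) (by positivity)]
  refine Real.rpow_le_rpow (by positivity) ?_ hδ.le
  calc 2 * r * (l ^ 2)⁻¹
      = 6912 * G * (k + 1) ^ 2 * (r / ((k + 1) * l) ^ 2 / (3456 * G)) := by
        field_simp; norm_num
    _ ≤ _ := by gcongr

lemma packingPre_le_of_isCompact {ψ : ℝ → ℝ} {μ : Measure ℝ} [IsFiniteMeasure μ] {K : Set ℝ}
    (hK : IsCompact K) {C : ℝ≥0∞} (hC : C ≠ ⊤) {ε : ℝ} (hε : 0 < ε)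
    (h : ∀ x ∈ K, ∀ r : ℝ, 0 < r → r ≤ ε → ENNReal.ofReal (ψ (2 * r)) ≤ C * μ (closedBall x r)) :
    packingPre ψ K ≤ C * μ K := by
  have hlim : Tendsto (fun η => C * μ (cthickening η K)) (𝓝[>] 0) (𝓝 (C * μ K)) :=
    ENNReal.Tendsto.const_mul
      ((tendsto_measure_cthickening_of_isCompact hK).mono_left nhdsWithin_le_nhds) (Or.inr hC)
  refine ge_of_tendsto hlim ?_
  filter_upwards [Ioc_mem_nhdsGT hε] with η hη
  refine (iInf₂_le η hη.1).trans (iSup_le fun D => iSup_le fun hDc => iSup_le fun hD =>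
    iSup_le fun hdisj => ?_)
  have := hDc.to_subtype
  calc ∑' p : D, ENNReal.ofReal (ψ (2 * (p : ℝ × ℝ).2))
      ≤ ∑' p : D, C * μ (closedBall (p : ℝ × ℝ).1 (p : ℝ × ℝ).2) := by
        refine ENNReal.tsum_le_tsum fun p => ?_
        obtain ⟨h1, h2, h3⟩ := hD p p.2
        exact h _ h1 _ h2 (by linarith [hη.2])
    _ = C * μ (⋃ p ∈ D, closedBall p.1 p.2) := by
        rw [ENNReal.tsum_mul_left, measure_biUnion hDc hdisj fun _ _ => measurableSet_closedBall]
    _ ≤ C * μ (cthickening η K) := by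
        gcongr
        refine iUnion₂_subset fun p hp => ?_
        obtain ⟨h1, h2, h3⟩ := hD p hp
        exact (closedBall_subset_closedBall (by linarith)).trans (closedBall_subset_cthickening h1 η)

lemma exists_isCompact_exhaustion {μ : Measure ℝ} [IsFiniteMeasure μ] {E : Set ℝ}
    (hE : MeasurableSet E) :
    ∃ K : ℕ → Set ℝ, (∀ n, IsCompact (K n) ∧ K n ⊆ E) ∧ ∑' n, μ (K n) ≤ 2 * μ E ∧
      μ (E \ ⋃ n, K n) = 0 := by
  have hf : ∀ F : {F : Set ℝ // MeasurableSet F}, ∃ K ⊆ F.1, IsCompact K ∧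
      μ (F.1 \ K) ≤ μ F.1 / 2 := by
    rintro ⟨F, hF⟩
    rcases eq_or_ne (μ F) 0 with h | h
    · exact ⟨∅, empty_subset _, isCompact_empty, by simp [h]⟩
    · obtain ⟨K, hKF, hK, hlt⟩ := hF.exists_isCompact_sdiff_lt (measure_ne_top μ F)
        (ε := μ F / 2) (ENNReal.div_pos h (by simp)).ne'
      exact ⟨K, hKF, hK, hlt.le⟩
  choose f hfF hf hfμ using hf
  let E' : ℕ → {F : Set ℝ // MeasurableSet F} := fun n =>
    Nat.rec ⟨E, hE⟩ (fun _ F => ⟨F.1 \ f F, F.2.diff (hf F).measurableSet⟩) n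
  have hsucc : ∀ n, (E' (n + 1)).1 = (E' n).1 \ f (E' n) := fun _ => rfl
  have hEμ : ∀ n, μ (E' n).1 ≤ 2⁻¹ ^ n * μ E := by
    intro n
    induction n with
    | zero => simp [E']
    | succ n ih =>
      rw [hsucc]
      refine (hfμ _).trans ?_
      rw [div_eq_mul_inv, pow_succ, mul_right_comm]
      gcongr
  have hE'E : ∀ n, (E' n).1 ⊆ E := by
    intro n
    induction n with
    | zero => exact subset_rfl
    | succ n ih => rw [hsucc]; exact sdiff_subset.trans ih
  have hdiff : ∀ n, E \ ⋃ n, f (E' n) ⊆ (E' n).1 := by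
    intro n
    induction n with
    | zero => exact sdiff_subset
    | succ n ih =>
      rw [hsucc]
      exact fun x hx => ⟨ih hx, fun h => hx.2 (mem_iUnion.2 ⟨n, h⟩)⟩
  refine ⟨fun n => f (E' n), fun n => ⟨hf _, (hfF _).trans (hE'E n)⟩, ?_, ?_⟩
  · calc ∑' n, μ (f (E' n)) ≤ ∑' n : ℕ, 2⁻¹ ^ n * μ E :=
          ENNReal.tsum_le_tsum fun n => (measure_mono (hfF _)).trans (hEμ n)
      _ = 2 * μ E := by
          rw [ENNReal.tsum_mul_right, ENNReal.tsum_geometric, ENNReal.one_sub_inv_two, inv_inv]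
  · have hlim : Tendsto (fun n : ℕ => (2⁻¹ : ℝ≥0∞) ^ n * μ E) atTop (𝓝 (0 * μ E)) :=
      ENNReal.Tendsto.mul_const
        (ENNReal.tendsto_pow_atTop_nhds_zero_of_lt_one (by simp)) (Or.inr (measure_ne_top μ E))
    rw [zero_mul] at hlim
    exact le_antisymm (ge_of_tendsto' hlim fun n => (measure_mono (hdiff n)).trans (hEμ n)) zero_le

lemma packingPsiOf_lt_top {ψ : ℝ → ℝ} {μ : Measure ℝ} [IsFiniteMeasure μ] {G : ℕ → Set ℝ}
    (hG : ∀ m, MeasurableSet (G m)) (hfull : ∀ᵐ x ∂μ, ∃ m, x ∈ G m) {C : ℝ≥0∞} (hC : C ≠ ⊤)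
    {ε : ℕ → ℝ} (hε : ∀ m, 0 < ε m)
    (h : ∀ m, ∀ x ∈ G m, ∀ r : ℝ, 0 < r → r ≤ ε m →
      ENNReal.ofReal (ψ (2 * r)) ≤ C * μ (closedBall x r)) :
    packingPsiOf ψ μ < ⊤ := by
  choose K hK hKμ hKnull using fun m =>
    exists_isCompact_exhaustion (μ := μ) (MeasurableSet.disjointed hG m)
  have hKG : ∀ m n, K m n ⊆ G m := fun m n => (hK m n).2.trans (disjointed_subset G m)
  set S : ℕ → Set ℝ := fun i => K i.unpair.1 i.unpair.2 with hS
  have hA : MeasurableSet (⋃ i, S i) :=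
    MeasurableSet.iUnion fun i => (hK i.unpair.1 i.unpair.2).1.measurableSet
  have hA' : μ (⋃ i, S i)ᶜ = 0 := by
    have h1 : ∀ᵐ x ∂μ, ∀ m, x ∉ disjointed G m \ ⋃ n, K m n :=
      ae_all_iff.2 fun m => measure_eq_zero_iff_ae_notMem.1 (hKnull m)
    rw [measure_eq_zero_iff_ae_notMem]
    filter_upwards [hfull, h1] with x hx hx1 hxA
    have hx2 : x ∈ ⋃ m, disjointed G m := by
      rw [iUnion_disjointed]; exact mem_iUnion.2 hx
    obtain ⟨m, hm⟩ := mem_iUnion.1 hx2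
    by_cases hxm : x ∈ ⋃ n, K m n
    · obtain ⟨n, hn⟩ := mem_iUnion.1 hxm
      exact hxA (mem_iUnion.2 ⟨Nat.pair m n, by simpa [hS] using hn⟩)
    · exact hx1 m ⟨hm, hxm⟩
  have hsum : ∑' i, packingPre ψ (S i) ≤ C * (2 * μ univ) := by
    calc ∑' i, packingPre ψ (S i) ≤ ∑' i, C * μ (S i) := ENNReal.tsum_le_tsum fun i =>
          packingPre_le_of_isCompact (hK _ _).1 hC (hε _) fun x hx => h _ x (hKG _ _ hx)
      _ = C * ∑' m, ∑' n, μ (K m n) := by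
          rw [ENNReal.tsum_mul_left, ← ENNReal.tsum_prod (f := fun m n => μ (K m n)),
            ← Nat.pairEquiv.symm.tsum_eq]
          rfl
      _ ≤ C * (2 * ∑' m, μ (disjointed G m)) := by
          refine mul_le_mul_right ?_ C
          rw [← ENNReal.tsum_mul_left]
          exact ENNReal.tsum_le_tsum hKμ
      _ ≤ C * (2 * μ univ) := by
          rw [← measure_iUnion (disjoint_disjointed G) fun m => MeasurableSet.disjointed hG m]
          exact mul_le_mul_right (mul_le_mul_right (measure_mono (subset_univ _)) 2) C
  calc packingPsiOf ψ μ ≤ packingPsi ψ (⋃ i, S i) := iInf_le_of_le _ (iInf₂_le hA hA')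
    _ ≤ ∑' i, packingPre ψ (S i) := iInf₂_le_of_le S Subset.rfl le_rfl
    _ ≤ C * (2 * μ univ) := hsum
    _ < ⊤ := ENNReal.mul_lt_top hC.lt_top
        (ENNReal.mul_lt_top ENNReal.ofNat_lt_top (measure_lt_top μ _))

lemma IsConformal.packingPsiOf_lt_top {δ : ℝ} (hδ₁ : 1 / 2 < δ) (hδ₂ : δ < 1)
    {μ : Measure ℝ} (hμ : IsConformal primes δ μ) {G : ℝ} (hG : 1 ≤ G)
    (hgap : ∀ X : ℝ, 2 ≤ X → ∃ b : ℕ, b.Prime ∧ X < b ∧ (b : ℝ) ≤ X + G * Real.log X ^ 2) :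
    packingPsiOf (fun r : ℝ => r ^ δ * Real.log (Real.log (1 / r)) ^ (-(2 * δ))) μ < ⊤ := by
  have := hμ.1
  obtain ⟨k, hk⟩ := hμ.exists_ae_eventually_lt hδ₁ hδ₂
  set S : ℕ → Set ℝ := fun m => primeCantor ∩
    ((⋂ n : ℕ, {x | m.unpair.1 + 9 ≤ n → (((n : ℝ) + 1) ^ k)⁻¹ < gaussT^[n] x}) ∩
      {x | (∏ l ∈ Finset.range (m.unpair.1 + 9), (gaussT^[l] x)⁻¹) ^ 2 ≤ (m.unpair.2 : ℝ)}) with hS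
  refine _root_.packingPsiOf_lt_top (G := S) (fun m => ?_) ?_ ENNReal.ofReal_ne_top
    (C := ENNReal.ofReal ((6912 * G * (k + 1) ^ 2) ^ δ))
    (ε := fun m => 4 / ((m.unpair.2 : ℝ) + 1)) (fun m => by positivity) ?_
  · refine measurableSet_primeCantor.inter ((MeasurableSet.iInter fun n => ?_).inter ?_)
    · by_cases hn : m.unpair.1 + 9 ≤ n
      · simp only [hn, true_imp_iff]
        exact measurableSet_lt measurable_const (measurable_gaussT.iterate n)
      · simp [hn]
    · refine measurableSet_le (Measurable.pow_const ?_ 2) measurable_const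
      exact Finset.measurable_prod _ fun l _ => (measurable_gaussT.iterate l).inv
  · filter_upwards [hμ.ae_mem, hk] with x hx hxk
    obtain ⟨i, hi⟩ := eventually_atTop.1 hxk
    obtain ⟨j, hj⟩ := exists_nat_ge ((∏ l ∈ Finset.range (i + 9), (gaussT^[l] x)⁻¹) ^ 2)
    refine ⟨Nat.pair i j, hx, mem_iInter.2 fun n hn => ?_, ?_⟩
    · rw [Nat.unpair_pair] at hn
      exact hi n (by simp only at hn; omega)
    · simpa [Nat.unpair_pair] using hj
  · rintro m x ⟨hx, hxk, hxj⟩ r hr hrε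
    refine hμ.psi_le_measure_closedBall (by linarith) hδ₂ hG hgap hx hr (i := m.unpair.1 + 9)
      (by omega) (fun n hn => mem_iInter.1 hxk n hn) ?_
    rw [den_digits hx]
    rw [le_div_iff₀ (by positivity)] at hrε
    have h1 : (∏ l ∈ Finset.range (m.unpair.1 + 9), (gaussT^[l] x)⁻¹) ^ 2 ≤ (m.unpair.2 : ℝ) := hxj
    nlinarith

lemma inv_eq_digit_add {y : ℝ} (hy : 0 < y) : y * (digit y + gaussT y) = 1 := by
  have := gaussMap_digit hy
  rw [gaussMap] at this
  have h0 : (digit y : ℝ) + gaussT y ≠ 0 := fun h => by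
    rw [h, div_zero] at this
    exact hy.ne this
  rw [div_eq_iff h0] at this
  exact this.symm

lemma digit_eq_of_isolated {q : ℕ} (hq : q.Prime) {k : ℝ} (hk : 2 ≤ k) (hkq : k ≤ q)
    (hiso : ∀ b : ℕ, b.Prime → b ≠ q → k ≤ |(b : ℝ) - q|) {y z : ℝ} (hy : y ∈ primeCantor)
    (hyq : digit y = q) (hz : z ∈ primeCantor) (hyz : |z - y| ≤ k / (32 * (q : ℝ) ^ 2)) :
    digit z = q := by
  by_contra hne
  have h1 := hiso _ (primeCantor_digit_prime hz) hne
  have hy0 := (primeCantor_mem_Ioo hy).1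
  have hz0 := (primeCantor_mem_Ioo hz).1
  have hyT := primeCantor_mem_Ioo (gaussT_mem_primeCantor hy)
  have hzT := primeCantor_mem_Ioo (gaussT_mem_primeCantor hz)
  have hyA := inv_eq_digit_add hy0
  have hzA := inv_eq_digit_add hz0
  rw [hyq] at hyA
  have hq2 : (2 : ℝ) ≤ q := by exact_mod_cast hq.two_le
  have hq0 : (0 : ℝ) < q := by linarith
  have hyl : 1 / (2 * q) ≤ y := by
    rw [div_le_iff₀ (by positivity)]
    nlinarith [hyT.2]
  have hρ : k / (32 * (q : ℝ) ^ 2) ≤ 1 / (32 * q) := by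
    rw [div_le_div_iff₀ (by positivity) (by positivity)]
    nlinarith
  have hzl : 15 / (32 * q) ≤ z := by
    have h2 : 1 / (2 * (q : ℝ)) - 1 / (32 * q) = 15 / (32 * q) := by
      field_simp; norm_num
    linarith [(abs_le.1 hyz).1]
  have h2 : z - y = z * y * ((q - digit z) + (gaussT y - gaussT z)) := by
    linear_combination y * hzA - z * hyA
  have h3 : k / 2 ≤ |((q : ℝ) - digit z) + (gaussT y - gaussT z)| := by
    have h4 : |gaussT y - gaussT z| ≤ 1 :=
      abs_le.2 ⟨by linarith [hyT.1, hzT.2], by linarith [hyT.2, hzT.1]⟩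
    have h5 := abs_sub_abs_le_abs_sub ((q : ℝ) - digit z) (-(gaussT y - gaussT z))
    rw [abs_neg, sub_neg_eq_add, abs_sub_comm] at h5
    linarith
  have h4 : 15 / (32 * q) * (1 / (2 * q)) * (k / 2) ≤ |z - y| := by
    rw [h2, abs_mul, abs_of_pos (mul_pos hz0 hy0)]
    gcongr
  have h5 : 15 / (32 * (q : ℝ)) * (1 / (2 * q)) * (k / 2) =
      15 / 4 * (k / (32 * (q : ℝ) ^ 2)) := by
    field_simp; norm_num
  have h6 : 0 < k / (32 * (q : ℝ) ^ 2) := by positivity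
  linarith

lemma closedBall_inter_subset_of_isolated {q : ℕ} (hq : q.Prime) {k : ℝ} (hk : 2 ≤ k)
    (hkq : k ≤ q) (hiso : ∀ b : ℕ, b.Prime → b ≠ q → k ≤ |(b : ℝ) - q|) {x : ℝ}
    (hx : x ∈ primeCantor) {n : ℕ} (hn : digit (gaussT^[n] x) = q) :
    closedBall x (k / (64 * (q : ℝ) ^ 2 * den (digits n x) (gaussT^[n] x) ^ 2)) ∩ primeCantor ⊆
      wordMap (digits n x) '' (gaussMap q '' Ioo 0 1) := by
  rintro x' ⟨hx', hx'p⟩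
  have hω2 := two_le_of_prime (prime_of_mem_digits hx n)
  have hy := iterate_mem_primeCantor hx n
  have hyI := iterate_mem_Icc hx n
  have hxy := wordMap_digits hx n
  have hωn := length_digits n x
  set y := gaussT^[n] x with hydef
  set ω := digits n x
  have hQ := den_pos hω2 hyI
  set Q := den ω y with hQdef
  have hy0 : 0 < y := (primeCantor_mem_Ioo hy).1
  have hyT := primeCantor_mem_Ioo (gaussT_mem_primeCantor hy)
  have hyA := inv_eq_digit_add hy0
  rw [hn] at hyA
  have hq2 : (2 : ℝ) ≤ q := by exact_mod_cast hq.two_le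
  have hq0 : (0 : ℝ) < q := by linarith
  set ρ := k / (32 * (q : ℝ) ^ 2) with hρdef
  have hρ0 : 0 < ρ := by positivity
  have hyl : 1 / (2 * q) ≤ y := by
    rw [div_le_iff₀ (by positivity)]
    nlinarith [hyT.2]
  have hρ : ρ ≤ 1 / (32 * q) := by
    rw [hρdef, div_le_div_iff₀ (by positivity) (by positivity)]
    nlinarith
  have hq1 : 1 / (32 * (q : ℝ)) < 1 / (2 * q) := by
    apply one_div_lt_one_div_of_lt <;> linarith
  have hq3 : 1 / (32 * (q : ℝ)) ≤ 1 / 64 :=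
    one_div_le_one_div_of_le (by norm_num) (by linarith)
  have hmem : ∀ z ∈ Icc (y - ρ) (y + ρ), z ∈ Ioo (0 : ℝ) 1 := fun z hz =>
    ⟨by linarith [hz.1], by linarith [hz.2, primeCantor_le_half hy]⟩
  have hle : ∀ z ∈ Icc (y - ρ) (y + ρ), |z - y| = ρ →
      k / (64 * (q : ℝ) ^ 2 * Q ^ 2) ≤ |z - y| / (den ω z * Q) := by
    intro z hz hzρ
    have hzI := Ioo_subset_Icc_self (hmem z hz)
    have hdz := den_pos hω2 hzI
    have h1 : k / (64 * (q : ℝ) ^ 2 * Q ^ 2) = ρ / (2 * Q * Q) := by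
      rw [hρdef]; field_simp; norm_num
    rw [h1, hzρ]
    gcongr
    exact den_le_two_mul_den hω2 hzI hyI
  have hl : y - ρ ∈ Icc (y - ρ) (y + ρ) := ⟨le_rfl, by linarith⟩
  have hr : y + ρ ∈ Icc (y - ρ) (y + ρ) := ⟨by linarith, le_rfl⟩
  have hl1 := hle _ hl (by rw [sub_sub_cancel_left, abs_neg, abs_of_pos hρ0])
  have hr1 := hle _ hr (by rw [add_sub_cancel_left, abs_of_pos hρ0])
  have hl2 := wordMap_sub_wordMap hω2 (Ioo_subset_Icc_self (hmem _ hl)) hyI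
  have hr2 := wordMap_sub_wordMap hω2 (Ioo_subset_Icc_self (hmem _ hr)) hyI
  rw [sub_sub_cancel_left, abs_neg, abs_of_pos hρ0] at hl1
  rw [add_sub_cancel_left, abs_of_pos hρ0] at hr1
  rw [sub_sub_cancel_left, hxy, ← hQdef, mul_div_assoc, neg_div] at hl2
  rw [add_sub_cancel_left, hxy, ← hQdef, mul_div_assoc] at hr2
  rw [mem_closedBall, Real.dist_eq, abs_le] at hx'
  have hcont : ContinuousOn (wordMap ω) (uIcc (y - ρ) (y + ρ)) := by
    rw [uIcc_of_le (by linarith)]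
    exact (continuousOn_wordMap hω2).mono fun z hz => Ioo_subset_Icc_self (hmem z hz)
  have hx'u : x' ∈ uIcc (wordMap ω (y - ρ)) (wordMap ω (y + ρ)) := by
    rw [mem_uIcc]
    rcases neg_one_pow_eq_or ℝ ω.length with h | h
    · rw [h] at hl2 hr2
      left; constructor <;> linarith [hx'.1, hx'.2]
    · rw [h] at hl2 hr2
      right; constructor <;> linarith [hx'.1, hx'.2]
  obtain ⟨z, hz, hzx⟩ := intermediate_value_uIcc hcont hx'u
  rw [uIcc_of_le (by linarith)] at hz
  have hz01 := hmem z hz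
  have hzT : gaussT^[n] x' = z := by
    rw [← hzx, ← hωn]
    exact (digits_wordMap hω2 hz01).2
  have hzp : z ∈ primeCantor := hzT ▸ iterate_mem_primeCantor hx'p n
  have hzq := digit_eq_of_isolated hq hk hkq hiso hy hn hzp
    (abs_le.2 ⟨by linarith [hz.1], by linarith [hz.2]⟩)
  exact ⟨z, ⟨gaussT z, primeCantor_mem_Ioo (gaussT_mem_primeCantor hzp), by
    rw [← hzq]; exact gaussMap_digit hz01.1⟩, hzx⟩

lemma IsConformal.measure_closedBall_le_of_isolated {δ : ℝ} (hδ : 0 < δ) {μ : Measure ℝ}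
    (hμ : IsConformal primes δ μ) {q : ℕ} (hq : q.Prime) {k : ℝ} (hk : 2 ≤ k)
    (hkq : k ≤ q) (hiso : ∀ b : ℕ, b.Prime → b ≠ q → k ≤ |(b : ℝ) - q|) {x : ℝ}
    (hx : x ∈ primeCantor) {n : ℕ} (hn : digit (gaussT^[n] x) = q) :
    μ (closedBall x (k / (64 * (q : ℝ) ^ 2 * den (digits n x) (gaussT^[n] x) ^ 2))) ≤
      ENNReal.ofReal ((4 / ((q : ℝ) ^ 2 * den (digits n x) (gaussT^[n] x) ^ 2)) ^ δ) := by
  have hω := prime_of_mem_digits hx n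
  have hQ := den_pos (two_le_of_prime hω) (iterate_mem_Icc hx n)
  have hq0 : (0 : ℝ) < q := by exact_mod_cast hq.pos
  have hpow : ∀ t : ℝ, 0 < t → t ^ (-(2 * δ)) = ((t ^ 2)⁻¹) ^ δ := fun t ht => by
    rw [← Real.rpow_natCast, ← Real.rpow_neg ht.le, ← Real.rpow_mul ht.le]
    norm_num
  have himg : gaussMap q '' Ioo 0 1 ⊆ Ioo 0 1 := by
    rintro _ ⟨z, hz, rfl⟩
    exact gaussMap_mem_Ioo hq.two_le hz.1.le
  calc μ (closedBall x (k / (64 * (q : ℝ) ^ 2 * den (digits n x) (gaussT^[n] x) ^ 2)))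
      = μ (closedBall x (k / (64 * (q : ℝ) ^ 2 * den (digits n x) (gaussT^[n] x) ^ 2)) ∩
          primeCantor) :=
        (measure_congr (inter_ae_eq_left_of_ae_eq_univ (eventuallyEq_univ.2 hμ.ae_mem))).symm
    _ ≤ μ (wordMap (digits n x) '' (gaussMap q '' Ioo 0 1)) :=
        measure_mono (closedBall_inter_subset_of_isolated hq hk hkq hiso hx hn)
    _ ≤ ENNReal.ofReal ((den (digits n x) (gaussT^[n] x) / 2) ^ (-(2 * δ))) *
          μ (gaussMap q '' Ioo 0 1) :=
        hμ.measure_wordMap_image_le hδ hω (measurableSet_wordMap_image (ω := [q])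
          (by simpa using hq.two_le) measurableSet_Ioo subset_rfl) himg (iterate_mem_Icc hx n)
    _ ≤ ENNReal.ofReal ((den (digits n x) (gaussT^[n] x) / 2) ^ (-(2 * δ))) *
          ENNReal.ofReal ((q : ℝ) ^ (-(2 * δ))) :=
        mul_le_mul_right (hμ.measure_gaussMap_image_le hδ hq) _
    _ = _ := by
        rw [← ENNReal.ofReal_mul (by positivity), hpow _ (by positivity), hpow _ hq0,
          ← Real.mul_rpow (by positivity) (by positivity)]
        congr 2
        field_simp
        norm_num

lemma exists_log_inv_iterate_le {x : ℝ} (hx : x ∈ primeCantor) {k : ℕ}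
    (hk : ∀ᶠ n : ℕ in atTop, (((n : ℝ) + 1) ^ k)⁻¹ < gaussT^[n] x) :
    ∃ M : ℝ, 0 ≤ M ∧ ∀ n : ℕ, Real.log (gaussT^[n] x)⁻¹ ≤ M + k * Real.log (n + 1) := by
  obtain ⟨i, hi⟩ := eventually_atTop.1 hk
  have hpos : ∀ n, 0 ≤ Real.log (gaussT^[n] x)⁻¹ := fun n => by
    have := primeCantor_mem_Ioo (iterate_mem_primeCantor hx n)
    exact Real.log_nonneg ((one_le_inv₀ this.1).2 this.2.le)
  refine ⟨∑ n ∈ Finset.range i, Real.log (gaussT^[n] x)⁻¹,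
    Finset.sum_nonneg fun n _ => hpos n, fun n => ?_⟩
  have hn : 0 ≤ k * Real.log ((n : ℝ) + 1) :=
    mul_nonneg k.cast_nonneg (Real.log_nonneg (by linarith [n.cast_nonneg (α := ℝ)]))
  rcases lt_or_ge n i with h | h
  · have := Finset.single_le_sum (f := fun n => Real.log (gaussT^[n] x)⁻¹)
      (fun n _ => hpos n) (Finset.mem_range.2 h)
    linarith
  · have h1 := hi n h
    have h0 := (primeCantor_mem_Ioo (iterate_mem_primeCantor hx n)).1
    have h2 : Real.log (gaussT^[n] x)⁻¹ ≤ k * Real.log (n + 1) := by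
      rw [← Real.log_pow]
      exact Real.log_le_log (by positivity) (inv_le_of_inv_le₀ (by positivity) h1.le)
    have := Finset.sum_nonneg fun n (_ : n ∈ Finset.range i) => hpos n
    linarith

lemma log_den_digits_le {x : ℝ} (hx : x ∈ primeCantor) {k : ℕ} {M : ℝ} (hM : 0 ≤ M)
    (h : ∀ n : ℕ, Real.log (gaussT^[n] x)⁻¹ ≤ M + k * Real.log (n + 1)) {n q : ℕ}
    (hn : n ≤ q ^ 3) (hq : 1 ≤ q) :
    Real.log (den (digits n x) (gaussT^[n] x)) ≤ (q : ℝ) ^ 3 * (M + 3 * k * q) := by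
  have hq0 : (1 : ℝ) ≤ q := by exact_mod_cast hq
  rw [den_digits hx, Real.log_prod fun i _ =>
    (inv_pos.2 (primeCantor_mem_Ioo (iterate_mem_primeCantor hx i)).1).ne']
  calc ∑ i ∈ Finset.range n, Real.log (gaussT^[i] x)⁻¹
      ≤ ∑ i ∈ Finset.range n, (M + 3 * k * q) := by
        refine Finset.sum_le_sum fun i hi => (h i).trans ?_
        have h1 : (i : ℝ) + 1 ≤ (q : ℝ) ^ 3 := by
          exact_mod_cast (Nat.succ_le_of_lt (Finset.mem_range.1 hi)).trans hn
        have h2 : Real.log ((i : ℝ) + 1) ≤ 3 * q := by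
          refine (Real.log_le_log (by positivity) h1).trans ?_
          rw [Real.log_pow]
          have := Real.log_le_self (x := q) (by linarith)
          push_cast
          linarith
        have h3 : (k : ℝ) * Real.log ((i : ℝ) + 1) ≤ k * (3 * q) := by gcongr
        linarith
    _ = n * (M + 3 * k * q) := by rw [Finset.sum_const, Finset.card_range, nsmul_eq_mul]
    _ ≤ (q : ℝ) ^ 3 * (M + 3 * k * q) := by
        gcongr
        exact_mod_cast hn

lemma IsConformal.exists_ae_measure_closedBall_le {δ : ℝ} (hδ₁ : 1 / 2 < δ) (hδ₂ : δ < 1)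
    {μ : Measure ℝ} (hμ : IsConformal primes δ μ) {c : ℝ} (hc : 0 < c)
    (hiso : ∀ N : ℕ, ∃ q : ℕ, q.Prime ∧ N ≤ q ∧
      ∀ b : ℕ, b.Prime → b ≠ q → c * Real.log q ^ 2 ≤ |(b : ℝ) - q|) :
    ∃ C : ℝ, 0 < C ∧ ∀ᵐ x ∂μ, ∀ ε : ℝ, 0 < ε → ∃ r : ℝ, 0 < r ∧ r ≤ ε ∧
      μ (closedBall x (5 * r)) ≤ ENNReal.ofReal C * ENNReal.ofReal
        ((2 * r) ^ δ * Real.log (Real.log (1 / (2 * r))) ^ (-(2 * δ))) := by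
  have hδ : 0 < δ := by linarith
  obtain ⟨k, hk⟩ := hμ.exists_ae_eventually_lt hδ₁ hδ₂
  set c' := min c (1 / 4) with hc'def
  have hc' : 0 < c' := lt_min hc (by norm_num)
  have hlarge : ∀ᶠ q : ℕ in atTop, 2 ≤ c' * Real.log q ^ 2 := by
    have h1 : Tendsto (fun q : ℕ => c' * Real.log q ^ 2) atTop atTop :=
      ((tendsto_pow_atTop two_ne_zero).comp
        (Real.tendsto_log_atTop.comp tendsto_natCast_atTop_atTop)).const_mul_atTop hc'
    exact h1.eventually_ge_atTop 2
  obtain ⟨N₀, hN₀⟩ := eventually_atTop.1 hlarge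
  set Q : Set ℕ := {q | q.Prime ∧ N₀ ≤ q ∧
    ∀ b : ℕ, b.Prime → b ≠ q → c' * Real.log q ^ 2 ≤ |(b : ℝ) - q|} with hQ
  have hQ' : ∀ N : ℕ, ∃ q ∈ Q, N ≤ q := fun N => by
    obtain ⟨q, hq, hNq, hb⟩ := hiso (max N N₀)
    refine ⟨q, ⟨hq, (le_max_right _ _).trans hNq, fun b hb1 hb2 => le_trans ?_ (hb b hb1 hb2)⟩,
      (le_max_left _ _).trans hNq⟩
    exact mul_le_mul_of_nonneg_right (min_le_left _ _) (sq_nonneg _)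
  refine ⟨(16000 / c') ^ δ, by positivity, ?_⟩
  filter_upwards [hμ.ae_mem, hk,
    hμ.ae_frequently_mem_digits hδ hδ₂ (fun q hq => hq.1) hQ'] with x hx hxk hxQ ε hε
  obtain ⟨M, hM, hMk⟩ := exists_log_inv_iterate_le hx hxk
  obtain ⟨N, hN⟩ := exists_nat_ge (100 + 2 * M + 6 * k + 1 / ε)
  obtain ⟨q, ⟨hq, hqN₀, hqiso⟩, hqN, hqd⟩ := hxQ N
  obtain ⟨n, hn, hnq⟩ := exists_of_mem_digits hqd
  have hN' : 100 + 2 * M + 6 * k + 1 / ε ≤ (q : ℝ) := hN.trans (by exact_mod_cast hqN)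
  have hε' : 0 < 1 / ε := by positivity
  have hk0 : (0 : ℝ) ≤ k := k.cast_nonneg
  have hq100 : (100 : ℝ) ≤ q := by linarith
  have hq0 : (0 : ℝ) < q := by linarith
  have hlq : 0 < Real.log q := Real.log_pos (by linarith)
  set K := c' * Real.log q ^ 2 with hK
  have hK2 : 2 ≤ K := hN₀ q hqN₀
  have hKq : K ≤ q := by
    have h1 : Real.log q ≤ 2 * √q := by
      have h2 := Real.log_le_self (Real.sqrt_nonneg (q : ℝ))
      rw [Real.log_sqrt hq0.le] at h2
      linarith
    have h3 : Real.log q ^ 2 ≤ 4 * q := by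
      calc Real.log q ^ 2 ≤ (2 * √(q : ℝ)) ^ 2 := by gcongr
        _ = 4 * (q : ℝ) := by rw [mul_pow, Real.sq_sqrt hq0.le]; norm_num
    calc K ≤ 1 / 4 * (4 * q) := mul_le_mul (min_le_right _ _) h3 (sq_nonneg _) (by norm_num)
      _ = q := by ring
  have hmain := hμ.measure_closedBall_le_of_isolated hδ hq hK2 hKq hqiso hx hnq
  have hlogD := log_den_digits_le hx hM hMk hn.le hq.one_le
  have hD1 : 1 ≤ den (digits n x) (gaussT^[n] x) :=
    (one_le_pow₀ one_le_two).trans (two_pow_le_den_digits hx n)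
  set D := den (digits n x) (gaussT^[n] x)
  set r := K / (320 * (q : ℝ) ^ 2 * D ^ 2) with hr
  have hr0 : 0 < r := by positivity
  have hr5 : K / (64 * (q : ℝ) ^ 2 * D ^ 2) = 5 * r := by rw [hr]; field_simp; norm_num
  rw [hr5] at hmain
  have hrq : r ≤ 1 / (320 * q) := by
    rw [hr, div_le_div_iff₀ (by positivity) (by positivity)]
    have : 1 ≤ D ^ 2 := one_le_pow₀ hD1
    have h2 : K * (320 * q) ≤ q * (320 * q) := by gcongr
    have h3 : 320 * (q : ℝ) ^ 2 * 1 ≤ 320 * (q : ℝ) ^ 2 * D ^ 2 := by gcongr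
    linarith
  refine ⟨r, hr0, ?_, ?_⟩
  · refine hrq.trans ?_
    rw [div_le_iff₀ (by positivity)]
    have : 1 / ε * ε ≤ q * ε := by gcongr; linarith
    rw [one_div_mul_cancel hε.ne'] at this
    nlinarith
  have hlow : 1 < Real.log (1 / (2 * r)) := by
    rw [Real.lt_log_iff_exp_lt (by positivity), lt_div_iff₀ (by positivity)]
    have h1 : 2 * r ≤ 1 / 160 * (1 / 100) := by
      have : 1 / (320 * (q : ℝ)) ≤ 1 / (320 * 100) :=
        one_div_le_one_div_of_le (by norm_num) (by linarith)
      linarith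
    have h2 := Real.exp_one_lt_d9
    nlinarith
  have hup : Real.log (1 / (2 * r)) ≤ (q : ℝ) ^ 5 := by
    have h1 : 1 / (2 * r) ≤ 80 * q ^ 2 * D ^ 2 := by
      rw [div_le_iff₀ (by positivity)]
      have h2 : 80 * (q : ℝ) ^ 2 * D ^ 2 * (2 * r) = K / 2 := by rw [hr]; field_simp; norm_num
      rw [h2]
      linarith
    refine (Real.log_le_log (by positivity) h1).trans ?_
    rw [Real.log_mul (by positivity) (by positivity), Real.log_mul (by norm_num) (by positivity),
      Real.log_pow, Real.log_pow]
    have h3 := Real.log_le_self (x := (80 : ℝ)) (by norm_num)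
    have h4 := Real.log_le_self hq0.le
    have h5 : (q : ℝ) ≤ q ^ 4 := le_self_pow₀ (by linarith) (by norm_num)
    have h6 : M * (q : ℝ) ^ 3 ≤ M * q ^ 4 := by
      gcongr
      · linarith
      · norm_num
    have h7 : (100 + 2 * M + 6 * k) * (q : ℝ) ^ 4 ≤ q * q ^ 4 := by gcongr; linarith
    push_cast
    linarith
  set l := Real.log (Real.log (1 / (2 * r)))
  have hl0 : 0 < l := Real.log_pos hlow
  have hl : l ≤ 5 * Real.log q := by
    refine (Real.log_le_log (by linarith) hup).trans ?_
    rw [Real.log_pow]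
    norm_num
  refine hmain.trans ?_
  rw [← ENNReal.ofReal_mul (by positivity)]
  refine ENNReal.ofReal_le_ofReal ?_
  have h2 : l ^ (-(2 * δ)) = ((l ^ 2)⁻¹) ^ δ := by
    rw [← Real.rpow_natCast, ← Real.rpow_neg (by positivity), ← Real.rpow_mul (by positivity)]
    norm_num
  rw [h2, ← Real.mul_rpow (by positivity) (by positivity),
    ← Real.mul_rpow (by positivity) (by positivity)]
  refine Real.rpow_le_rpow (by positivity) ?_ hδ.le
  calc 4 / ((q : ℝ) ^ 2 * D ^ 2)
      = 16000 / c' * (2 * r * ((5 * Real.log q) ^ 2)⁻¹) := by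
        rw [hr, hK]; field_simp; norm_num
    _ ≤ _ := by gcongr

lemma measure_inter_div_le_packingPre {ψ : ℝ → ℝ} {μ : Measure ℝ} {A : Set ℝ} {C : ℝ≥0∞}
    (h : ∀ x ∈ A, ∀ ε : ℝ, 0 < ε → ∃ r : ℝ, 0 < r ∧ r ≤ ε ∧
      μ (closedBall x (5 * r)) ≤ C * ENNReal.ofReal (ψ (2 * r))) (S : Set ℝ) :
    μ (S ∩ A) / C ≤ packingPre ψ S := by
  refine le_iInf₂ fun ε hε => ENNReal.div_le_of_le_mul' ?_
  set t : Set (ℝ × ℝ) := {p | p.1 ∈ S ∧ 0 < p.2 ∧ 2 * p.2 ≤ ε ∧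
    μ (closedBall p.1 (5 * p.2)) ≤ C * ENNReal.ofReal (ψ (2 * p.2))} with ht
  obtain ⟨u, hut, hdisj, hcov⟩ := Vitali.exists_disjoint_subfamily_covering_enlargement_closedBall
    t Prod.fst Prod.snd ε (fun p hp => by linarith [hp.2.1, hp.2.2.1]) 5 (by norm_num)
  have hu : u.Countable := hdisj.countable_of_nonempty_interior fun p hp =>
    ⟨p.1, ball_subset_interior_closedBall (mem_ball_self (hut hp).2.1)⟩
  calc μ (S ∩ A) ≤ μ (⋃ p ∈ u, closedBall p.1 (5 * p.2)) := by
        refine measure_mono fun x hx => ?_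
        obtain ⟨r, hr, hrε, hrμ⟩ := h x hx.2 (ε / 2) (by linarith)
        obtain ⟨p, hp, hpx⟩ := hcov (x, r) ⟨hx.1, hr, by linarith, hrμ⟩
        exact mem_biUnion hp (hpx (mem_closedBall_self hr.le))
    _ ≤ ∑' p : u, μ (closedBall p.1.1 (5 * p.1.2)) := measure_biUnion_le μ hu _
    _ ≤ ∑' p : u, C * ENNReal.ofReal (ψ (2 * p.1.2)) :=
        ENNReal.tsum_le_tsum fun p => (hut p.2).2.2.2
    _ = C * ∑' p : u, ENNReal.ofReal (ψ (2 * p.1.2)) := ENNReal.tsum_mul_left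
    _ ≤ _ := by
        refine mul_le_mul_right ?_ C
        exact le_iSup_of_le u (le_iSup_of_le hu (le_iSup_of_le
          (fun p hp => ⟨(hut hp).1, (hut hp).2.1, (hut hp).2.2.1⟩)
          (le_iSup_of_le hdisj le_rfl)))

lemma packingPsiOf_pos {ψ : ℝ → ℝ} {μ : Measure ℝ} [IsProbabilityMeasure μ] {C : ℝ≥0∞}
    (hC : C ≠ ⊤)
    (h : ∀ᵐ x ∂μ, ∀ ε : ℝ, 0 < ε → ∃ r : ℝ, 0 < r ∧ r ≤ ε ∧
      μ (closedBall x (5 * r)) ≤ C * ENNReal.ofReal (ψ (2 * r))) :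
    0 < packingPsiOf ψ μ := by
  refine (ENNReal.div_pos one_ne_zero hC).trans_le ?_
  refine le_iInf fun A => le_iInf₂ fun _ hA => le_iInf₂ fun S hS => ?_
  set A₀ := {x | ∀ ε : ℝ, 0 < ε → ∃ r : ℝ, 0 < r ∧ r ≤ ε ∧
      μ (closedBall x (5 * r)) ≤ C * ENNReal.ofReal (ψ (2 * r))} with hA₀
  have hfull : (1 : ℝ≥0∞) ≤ ∑' i, μ (S i ∩ A₀) := by
    rw [← measure_univ (μ := μ)]
    refine le_trans (measure_mono_ae ?_) (measure_iUnion_le fun i => S i ∩ A₀)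
    filter_upwards [h, measure_eq_zero_iff_ae_notMem.1 hA] with x hx hxA _
    obtain ⟨i, hi⟩ := mem_iUnion.1 (hS (not_not.1 hxA))
    exact mem_iUnion.2 ⟨i, hi, hx⟩
  calc 1 / C ≤ (∑' i, μ (S i ∩ A₀)) / C := by gcongr
    _ = ∑' i, μ (S i ∩ A₀) / C := by
        simp only [div_eq_mul_inv, ENNReal.tsum_mul_right]
    _ ≤ ∑' i, packingPre ψ (S i) :=
        ENNReal.tsum_le_tsum fun i => measure_inter_div_le_packingPre (fun x hx => hx) (S i)

/-- Theorem 4. Assume the cases `k = 1, 2` of the Cramér–Granville-type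
conjecture: `0 < R₁ < ∞` and `0 < R₂ < ∞`, where `R_k` is the limsup of
`min(d_{n+1},…,d_{n+k})/log²(p_n)`. Then `0 < P^ψ(μ_P) < ∞` for
`ψ(r) = r^δ (loglog(1/r))^{-2δ}`. -/
theorem stmt5 (δ : ℝ) (hδ₁ : 1 / 2 < δ) (hδ₂ : δ < 1) (hpress : pressure primes δ = 0)
    (μ : Measure ℝ) (hμ : IsConformal primes δ μ)
    (p : ℕ → ℕ) (hp : p = Nat.nth Nat.Prime)
    (d : ℕ → ℕ) (hd : ∀ n, d n = p (n + 1) - p n)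
    (R₁ R₂ : ℝ≥0∞)
    (hR₁ : R₁ = limsup (fun n : ℕ =>
      ENNReal.ofReal ((d (n + 1) : ℝ) / Real.log (p n) ^ 2)) atTop)
    (hR₂ : R₂ = limsup (fun n : ℕ =>
      ENNReal.ofReal (min (d (n + 1) : ℝ) (d (n + 2) : ℝ) / Real.log (p n) ^ 2)) atTop)
    (h₁ : 0 < R₁ ∧ R₁ < ⊤) (h₂ : 0 < R₂ ∧ R₂ < ⊤)
    (ψ : ℝ → ℝ) (hψ : ψ = fun r : ℝ => r ^ δ * Real.log (Real.log (1 / r)) ^ (-(2 * δ))) :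
    0 < packingPsiOf ψ μ ∧ packingPsiOf ψ μ < ⊤ := by
  have := hμ.1
  subst hp hψ
  simp only [hd] at hR₁ hR₂
  obtain ⟨G, hG, hgap⟩ := exists_prime_gap_le (hR₁ ▸ h₁.2)
  obtain ⟨c, hc, hiso⟩ := exists_isolated_prime (hR₂ ▸ h₂.1)
  obtain ⟨C, _, hC⟩ := hμ.exists_ae_measure_closedBall_le hδ₁ hδ₂ hc hiso
  exact ⟨packingPsiOf_pos ENNReal.ofReal_ne_top hC,
    hμ.packingPsiOf_lt_top hδ₁ hδ₂ hG hgap⟩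
end
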